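/- Let S be a finite family of n axis-parallel line segments in the plane (each segment parallel to the x-axis or to the y-axis, no two segments overlapping in more than one point) and let C be a family of pairwise disjoint curves which is grounded with respect to S. Then the Delaunay graph D(S, C) has at most 13n − 11 edges. -/

import Mathlib

open Set

/-- Points of the plane. -/
abbrev Pt : Type := ℝ × ℝ

/-- A curve: the image of an injective continuous map from `[0,1]` to the plane. -/
def IsCurve (s : Set Pt) : Prop :=
  ∃ f : ℝ → Pt, ContinuousOn f (Set.Icc 0 1) ∧ Set.InjOn f (Set.Icc 0 1) ∧
    s = f '' Set.Icc 0 1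

/-- A simple polygonal chain consisting of finitely many line segments. -/
def IsPolygonalCurve (s : Set Pt) : Prop :=
  IsCurve s ∧ ∃ P : Finset (Pt × Pt), s = ⋃ p ∈ P, segment ℝ p.1 p.2

/-- The family `C` is grounded with respect to `S` if some connected component of the
complement of `⋃ S` contains at least one point of every curve in `C`. -/
def Grounded {ι κ : Type*} (C : ι → Set Pt) (S : κ → Set Pt) : Prop :=
  ∃ x : Pt, x ∉ (⋃ k, S k) ∧
    ∀ i, (connectedComponentIn (⋃ k, S k)ᶜ x ∩ C i).Nonempty

section Counting

variable {V E F : Type*} [Fintype V] [Fintype E]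

/-- A chain modulo two is a cycle if it is orthogonal to all cuts. -/
def IsModTwoCycle (p q : E → V) (z : E → ZMod 2) : Prop :=
  ∀ ψ : V → ZMod 2, ∑ e, z e * (ψ (p e) + ψ (q e)) = 0

/-- The graph with edge ends `p, q` and the graph with edge ends `l, r` are dual: the cuts of the
second one are exactly the cycles of the first one. -/
def IsDualPair (p q : E → V) (l r : E → F) : Prop :=
  ∀ z : E → ZMod 2, IsModTwoCycle p q z ↔ ∃ φ : F → ZMod 2, ∀ e, z e = φ (l e) + φ (r e)

theorem card_le_of_isDualPair {p q : E → V} {l r : E → F} (h : IsDualPair p q l r) (g : ℕ)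
    (hg : ∀ z : E → ZMod 2, IsModTwoCycle p q z → z ≠ 0 → g ≤ {e | z e ≠ 0}.ncard) :
    Fintype.card E = 0 ∨ Fintype.card E + 1 ≤ Fintype.card V ∨
      ∃ f, Fintype.card E + 2 ≤ Fintype.card V + f ∧ g * f ≤ 2 * Fintype.card E := by
  classical
  rcases isEmpty_or_nonempty E with hE | ⟨⟨e₀⟩⟩
  · left; simp
  right
  let v₀ := p e₀
  let D : (E → ZMod 2) →ₗ[ZMod 2] ({v : V // v ≠ v₀} → ZMod 2) :=
    { toFun := fun z v => ∑ e, z e * ((if p e = v then 1 else 0) + (if q e = v then 1 else 0))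
      map_add' := by
        intro x y; ext v; simp only [Pi.add_apply, add_mul, Finset.sum_add_distrib]
      map_smul' := by
        intro c x; ext v
        simp only [Pi.smul_apply, smul_eq_mul, Finset.mul_sum, mul_assoc, RingHom.id_apply] }
  have hD : ∀ z, D z = 0 → IsModTwoCycle p q z := by
    intro z hz ψ
    have h1 : ∀ e, ψ (p e) + ψ (q e) = ∑ v : {v : V // v ≠ v₀}, (ψ v + ψ v₀) *
        ((if p e = v then 1 else 0) + (if q e = v then 1 else 0)) := by
      have key : ∀ w : V, ∑ v : {v : V // v ≠ v₀}, (ψ v + ψ v₀) * (if w = v then 1 else 0)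
          = ψ w + ψ v₀ := by
        intro w
        by_cases hw : w = v₀
        · rw [hw, CharTwo.add_self_eq_zero]
          apply Finset.sum_eq_zero
          intro v _
          rw [if_neg (fun h => v.2 h.symm), mul_zero]
        · rw [Finset.sum_eq_single (⟨w, hw⟩ : {v : V // v ≠ v₀})]
          · simp
          · intro b _ hb
            rw [if_neg, mul_zero]
            rintro rfl; exact hb rfl
          · simp
      intro e
      simp only [mul_add, Finset.sum_add_distrib]
      rw [key, key]
      have := CharTwo.add_self_eq_zero (ψ v₀)
      linear_combination -this
    calc ∑ e, z e * (ψ (p e) + ψ (q e))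
        = ∑ e, ∑ v : {v : V // v ≠ v₀}, (ψ v + ψ v₀) *
          (z e * ((if p e = v then 1 else 0) + (if q e = v then 1 else 0))) := by
          refine Finset.sum_congr rfl fun e _ => ?_
          rw [h1, Finset.mul_sum]
          refine Finset.sum_congr rfl fun v _ => ?_
          ring
      _ = ∑ v : {v : V // v ≠ v₀}, (ψ v + ψ v₀) * D z v := by
          rw [Finset.sum_comm]
          refine Finset.sum_congr rfl fun v _ => ?_
          rw [← Finset.mul_sum]
          rfl
      _ = 0 := by simp [hz]
  have hV : 1 ≤ Fintype.card V := Fintype.card_pos_iff.2 ⟨v₀⟩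
  have hrank : Fintype.card E ≤ Module.finrank (ZMod 2) (LinearMap.ker D) +
      (Fintype.card V - 1) := by
    have h1 := LinearMap.finrank_range_add_finrank_ker D
    have h2 : Module.finrank (ZMod 2) (LinearMap.range D) ≤ Fintype.card V - 1 := by
      refine (Submodule.finrank_le _).trans ?_
      rw [Module.finrank_fintype_fun_eq_card, Fintype.card_subtype_compl]
      simp
    rw [Module.finrank_fintype_fun_eq_card] at h1
    omega
  let star : F → E → ZMod 2 := fun f e => (if l e = f then 1 else 0) + (if r e = f then 1 else 0)
  let A : Finset F := (Finset.univ.image l ∪ Finset.univ.image r).filter fun f => star f ≠ 0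
  have hstar : ∀ (φ : F → ZMod 2) e, φ (l e) + φ (r e) = ∑ f ∈ A, φ f * star f e := by
    intro φ e
    rw [Finset.sum_filter_of_ne]
    · simp only [star, mul_add, Finset.sum_add_distrib, mul_ite, mul_one, mul_zero]
      rw [Finset.sum_ite_eq, Finset.sum_ite_eq, if_pos, if_pos] <;> simp
    · intro f _ hf h0
      apply hf
      rw [h0]; simp
  have hcyc : ∀ f, IsModTwoCycle p q (star f) := by
    intro f
    refine (h _).2 ⟨fun f' => if f' = f then 1 else 0, fun e => rfl⟩
  have hcount : g * A.card ≤ 2 * Fintype.card E := by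
    calc g * A.card = ∑ f ∈ A, g := by simp [mul_comm]
      _ ≤ ∑ f ∈ A, (Finset.univ.filter fun e => star f e ≠ 0).card := by
          refine Finset.sum_le_sum fun f hf => ?_
          have := hg _ (hcyc f) (Finset.mem_filter.1 hf).2
          rwa [Set.ncard_eq_toFinset_card', Set.toFinset_ofPred] at this
      _ = ∑ e : E, (A.filter fun f => star f e ≠ 0).card := by
          simp only [Finset.card_filter]
          rw [Finset.sum_comm]
      _ ≤ ∑ e : E, 2 := by
          refine Finset.sum_le_sum fun e _ => ?_
          refine le_trans (Finset.card_le_card (t := {l e, r e}) ?_) Finset.card_le_two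
          intro f hf
          have := (Finset.mem_filter.1 hf).2
          by_contra hne
          simp only [Finset.mem_insert, Finset.mem_singleton, not_or] at hne
          apply this
          simp only [star]
          rw [if_neg (fun h => hne.1 h.symm), if_neg (fun h => hne.2 h.symm), add_zero]
      _ = 2 * Fintype.card E := by simp [mul_comm]
  rcases A.eq_empty_or_nonempty with hA | ⟨f₀, hf₀⟩
  · left
    have : LinearMap.ker D = ⊥ := by
      rw [eq_bot_iff]
      intro z hz
      obtain ⟨φ, hφ⟩ := (h z).1 (hD z hz)
      rw [Submodule.mem_bot]
      ext e
      rw [hφ, hstar, hA]; simp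
    rw [this, finrank_bot] at hrank
    omega
  · right
    refine ⟨A.card, ?_, hcount⟩
    let Ψ : (↥(A.erase f₀) → ZMod 2) →ₗ[ZMod 2] (E → ZMod 2) :=
      { toFun := fun φ e => ∑ f, φ f * star f e
        map_add' := by
          intro x y; ext v; simp [add_mul, Finset.sum_add_distrib]
        map_smul' := by
          intro c x; ext v; simp [Finset.mul_sum, mul_assoc] }
    have hle : LinearMap.ker D ≤ LinearMap.range Ψ := by
      intro z hz
      obtain ⟨φ, hφ⟩ := (h z).1 (hD z hz)
      refine ⟨fun f => φ f + φ f₀, ?_⟩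
      ext e
      have h1 := hstar (fun f => φ f + φ f₀) e
      rw [← Finset.add_sum_erase _ _ hf₀, CharTwo.add_self_eq_zero, zero_mul, zero_add] at h1
      change ∑ f : ↥(A.erase f₀), (φ f + φ f₀) * star f e = z e
      rw [Finset.sum_coe_sort (A.erase f₀) (fun f => (φ f + φ f₀) * star f e), ← h1, hφ]
      have := CharTwo.add_self_eq_zero (φ f₀)
      linear_combination this
    have h2 := (Submodule.finrank_mono hle).trans (LinearMap.finrank_range_le Ψ)
    rw [Module.finrank_fintype_fun_eq_card, Fintype.card_coe, Finset.card_erase_of_mem hf₀] at h2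
    have : 1 ≤ A.card := Finset.card_pos.2 ⟨f₀, hf₀⟩
    omega

omit [Fintype V] in
theorem IsModTwoCycle.exists_ne {p q : E → V} {z : E → ZMod 2} (h : IsModTwoCycle p q z)
    (hpq : ∀ e, p e ≠ q e) {e : E} (he : z e ≠ 0) {v : V} (hv : p e = v ∨ q e = v) :
    ∃ e' ≠ e, z e' ≠ 0 ∧ (p e' = v ∨ q e' = v) := by
  classical
  by_contra! hcon
  have h1 := h (fun w => if w = v then 1 else 0)
  rw [Finset.sum_eq_single e] at h1
  · have := hpq e
    rcases hv with rfl | rfl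
    · simp [this.symm, he] at h1
    · simp [this, he] at h1
  · intro e' _ hne
    by_cases hz : z e' = 0
    · simp [hz]
    · have := hcon e' hne hz
      simp [this.1, this.2]
  · simp

theorem card_le_of_isDualPair_of_simple {p q : E → V} {l r : E → F} (h : IsDualPair p q l r)
    (hpq : ∀ e, p e ≠ q e) (hinj : Function.Injective fun e => s(p e, q e)) :
    Fintype.card E = 0 ∨ Fintype.card E + 1 ≤ Fintype.card V ∨
      Fintype.card E + 6 ≤ 3 * Fintype.card V := by
  classical
  have := card_le_of_isDualPair h 3 ?_
  · rcases this with h0 | h1 | ⟨f, hf, hf'⟩ <;> omega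
  · intro z hz hne
    obtain ⟨e, he⟩ := Function.ne_iff.1 hne
    obtain ⟨e₁, hne₁, hz₁, hv₁⟩ := hz.exists_ne hpq he (Or.inl rfl)
    obtain ⟨e₂, hne₂, hz₂, hv₂⟩ := hz.exists_ne hpq he (Or.inr rfl)
    have h12 : e₁ ≠ e₂ := by
      rintro rfl
      apply hne₁
      apply hinj
      have := hpq e
      have := hpq e₁
      simp only [Sym2.eq_iff]
      grind
    have h3 : ({e, e₁, e₂} : Set E).ncard = 3 := by
      rw [Set.ncard_eq_three]
      exact ⟨e, e₁, e₂, hne₁.symm, hne₂.symm, h12, rfl⟩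
    rw [← h3]
    apply Set.ncard_le_ncard _ (Set.toFinite _)
    rintro x (rfl | rfl | rfl)
    exacts [he, hz₁, hz₂]

theorem card_le_of_isDualPair_of_bipartite {p q : E → V} {l r : E → F} (h : IsDualPair p q l r)
    {side : V → Prop} (hp : ∀ e, side (p e)) (hq : ∀ e, ¬ side (q e))
    (hinj : Function.Injective fun e => s(p e, q e)) :
    Fintype.card E = 0 ∨ Fintype.card E + 1 ≤ Fintype.card V ∨
      Fintype.card E + 4 ≤ 2 * Fintype.card V := by
  classical
  have hpq : ∀ e e', p e ≠ q e' := fun e e' h => hq e' (h ▸ hp e)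
  have hinj' : ∀ e e', p e = p e' → q e = q e' → e = e' := by
    intro e e' h h'
    apply hinj
    simp [h, h']
  have := card_le_of_isDualPair h 4 ?_
  · rcases this with h0 | h1 | ⟨f, hf, hf'⟩ <;> omega
  · intro z hz hne
    obtain ⟨e, he⟩ := Function.ne_iff.1 hne
    obtain ⟨e₁, hne₁, hz₁, hv₁⟩ := hz.exists_ne (fun e => hpq e e) he (Or.inl rfl)
    obtain ⟨e₂, hne₂, hz₂, hv₂⟩ := hz.exists_ne (fun e => hpq e e) he (Or.inr rfl)
    obtain ⟨e₃, hne₃, hz₃, hv₃⟩ := hz.exists_ne (fun e => hpq e e) hz₁ (Or.inr rfl)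
    have hv₁' := hv₁.resolve_right (hpq _ _).symm
    have hv₂' := hv₂.resolve_left (hpq _ _)
    have hv₃' := hv₃.resolve_left (hpq _ _)
    have hq₁ : q e₁ ≠ q e := fun h => hne₁ (hinj' _ _ hv₁' h)
    have h4 : ({e, e₁, e₂, e₃} : Finset E).card = 4 := by
      rw [Finset.card_insert_of_notMem, Finset.card_eq_three.2]
      · refine ⟨e₁, e₂, e₃, ?_, hne₃.symm, ?_, rfl⟩
        · rintro rfl; exact hq₁ hv₂'
        · rintro rfl; exact hq₁ (hv₃'.symm.trans hv₂')
      · simp only [Finset.mem_insert, Finset.mem_singleton, not_or]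
        refine ⟨hne₁.symm, hne₂.symm, ?_⟩
        rintro rfl; exact hq₁ hv₃'.symm
    rw [← h4, ← Set.ncard_coe_finset]
    apply Set.ncard_le_ncard _ (Set.toFinite _)
    intro x hx
    simp only [Finset.coe_insert, Finset.coe_singleton, Set.mem_insert_iff,
      Set.mem_singleton_iff] at hx
    rcases hx with rfl | rfl | rfl | rfl
    exacts [he, hz₁, hz₂, hz₃]

end Counting

section Grid

/-- Edges of the square grid: `(i, j, b)` starts at `(i, j)` and is vertical if `b` is true. -/
abbrev GridEdge : Type := ℤ × ℤ × Bool

namespace GridEdge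

def src (e : GridEdge) : ℤ × ℤ := (e.1, e.2.1)

def tgt (e : GridEdge) : ℤ × ℤ := bif e.2.2 then (e.1, e.2.1 + 1) else (e.1 + 1, e.2.1)

/-- Unit squares are indexed by their lower left corners; this is one of the two squares at `e`. -/
def left (e : GridEdge) : ℤ × ℤ := (e.1, e.2.1)

/-- The other square at `e`. -/
def right (e : GridEdge) : ℤ × ℤ := bif e.2.2 then (e.1 - 1, e.2.1) else (e.1, e.2.1 - 1)

end GridEdge

open GridEdge

/-- Adjacency in the square grid. -/
def GridAdj (a b : ℤ × ℤ) : Prop :=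
  ∃ e : GridEdge, (src e = a ∧ tgt e = b) ∨ (src e = b ∧ tgt e = a)

theorem GridAdj.symm {a b : ℤ × ℤ} (h : GridAdj a b) : GridAdj b a := by
  obtain ⟨e, he⟩ := h
  exact ⟨e, he.symm⟩

/-- The boundary of a chain modulo two. -/
noncomputable def gridBoundary : (GridEdge →₀ ZMod 2) →ₗ[ZMod 2] (ℤ × ℤ →₀ ZMod 2) :=
  Finsupp.linearCombination (ZMod 2) fun e => Finsupp.single (src e) 1 + Finsupp.single (tgt e) 1

theorem gridBoundary_apply (z : GridEdge →₀ ZMod 2) (i j : ℤ) :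
    gridBoundary z (i, j) =
      z (i, j, false) + z (i - 1, j, false) + z (i, j, true) + z (i, j - 1, true) := by
  induction z using Finsupp.induction_linear with
  | zero => simp
  | add f g hf hg => rw [map_add]; simp only [Finsupp.add_apply, hf, hg]; ring
  | single e c =>
    obtain ⟨x, y, b⟩ := e
    simp only [gridBoundary, Finsupp.linearCombination_single, Finsupp.smul_apply,
      Finsupp.add_apply, Finsupp.single_apply, src, tgt, Prod.mk.injEq]
    cases b
    · simp only [cond_false, and_true, and_false, if_false, reduceCtorEq]
      have h1 : (x = i - 1 ∧ y = j) ↔ (x + 1 = i ∧ y = j) := by omega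
      rw [if_congr h1 rfl rfl]
      simp only [Prod.mk.injEq, smul_eq_mul, mul_add, mul_ite, mul_one, mul_zero, add_zero]
    · simp only [cond_true, and_true, and_false, if_false, reduceCtorEq]
      have h1 : (x = i ∧ y = j - 1) ↔ (x = i ∧ y + 1 = j) := by omega
      rw [if_congr h1 rfl rfl]
      simp only [Prod.mk.injEq, smul_eq_mul, mul_add, mul_ite, mul_one, mul_zero, zero_add,
        add_zero]

theorem sum_eq_zero_of_gridBoundary_eq_zero {z : GridEdge →₀ ZMod 2} (hz : gridBoundary z = 0)
    (ψ : ℤ × ℤ → ZMod 2) : z.sum (fun e c => c * (ψ (src e) + ψ (tgt e))) = 0 := by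
  have h : ∀ z, Finsupp.linearCombination (ZMod 2) ψ (gridBoundary z) =
      z.sum (fun e c => c * (ψ (src e) + ψ (tgt e))) := by
    intro z
    rw [gridBoundary, Finsupp.linearCombination_apply (R := ZMod 2) (l := z), map_finsuppSum]
    refine Finsupp.sum_congr fun e _ => ?_
    simp [mul_add]
  rw [← h, hz, map_zero]

theorem exists_potential_of_gridBoundary_eq_zero {z : GridEdge →₀ ZMod 2}
    (hz : gridBoundary z = 0) : ∃ φ : ℤ × ℤ → ZMod 2, ∀ e, z e = φ (left e) + φ (right e) := by
  obtain ⟨M, hM⟩ : ∃ M : ℤ, ∀ e ∈ z.support, M ≤ e.2.1 := by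
    have hb : BddBelow ((fun e : GridEdge => e.2.1) '' (z.support : Set GridEdge)) :=
      (z.support.finite_toSet.image _).bddBelow
    obtain ⟨M, hM⟩ := hb
    exact ⟨M, fun e he => hM ⟨e, he, rfl⟩⟩
  have hM' : ∀ i j b, j < M → z (i, j, b) = 0 := by
    intro i j b hj
    by_contra hne
    have := hM (i, j, b) (Finsupp.mem_support_iff.2 hne)
    exact absurd this (not_le.2 hj)
  let φ : ℤ × ℤ → ZMod 2 := fun x => ∑ k ∈ Finset.Icc M x.2, z (x.1, k, false)
  have h1 : ∀ i j, φ (i, j) = φ (i, j - 1) + z (i, j, false) := by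
    intro i j
    simp only [φ]
    by_cases hj : M ≤ j
    · have : Finset.Icc M j = insert j (Finset.Icc M (j - 1)) := by
        ext k; simp only [Finset.mem_Icc, Finset.mem_insert]; omega
      rw [this, Finset.sum_insert, add_comm]
      simp
    · rw [hM' i j _ (by omega), add_zero, Finset.Icc_eq_empty (by omega),
        Finset.Icc_eq_empty (by omega)]
  have h2 : ∀ (n : ℕ) i j, j < M + n → φ (i, j) + φ (i - 1, j) = z (i, j, true) := by
    intro n
    induction n with
    | zero =>
      intro i j hj
      simp only [Nat.cast_zero, add_zero] at hj
      simp only [φ]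
      rw [hM' i j _ hj, Finset.Icc_eq_empty (by simpa using hj)]
      simp
    | succ n ih =>
      intro i j hj
      have h3 := ih i (j - 1) (by push_cast at hj; omega)
      have h4 : gridBoundary z (i, j) = 0 := by rw [hz]; rfl
      rw [gridBoundary_apply] at h4
      rw [h1 i j, h1 (i - 1) j]
      have h5 := CharTwo.add_self_eq_zero (z (i, j, true))
      linear_combination h3 + h4 - h5
  refine ⟨φ, ?_⟩
  rintro ⟨i, j, b⟩
  cases b
  · simp only [left, right, cond_false]
    rw [h1 i j]
    have := CharTwo.add_self_eq_zero (φ (i, j - 1))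
    linear_combination - this
  · simp only [left, right, cond_true]
    rw [h2 (j + 1 - M).toNat i j (by omega)]

theorem gridBoundary_eq_zero_of_potential {z : GridEdge →₀ ZMod 2} {φ : ℤ × ℤ → ZMod 2}
    (h : ∀ e, z e = φ (left e) + φ (right e)) : gridBoundary z = 0 := by
  ext ⟨i, j⟩
  rw [gridBoundary_apply, h, h, h, h]
  simp only [left, right, cond_true, cond_false, Finsupp.coe_zero, Pi.zero_apply]
  have h1 := CharTwo.add_self_eq_zero (φ (i, j))
  have h2 := CharTwo.add_self_eq_zero (φ (i - 1, j))
  have h3 := CharTwo.add_self_eq_zero (φ (i, j - 1))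
  have h4 := CharTwo.add_self_eq_zero (φ (i - 1, j - 1))
  linear_combination h1 + h2 + h3 + h4

/-- Any two points of `Y` are joined by a grid path inside `Y`. -/
def GridConnected (Y : Set (ℤ × ℤ)) : Prop :=
  ∀ x ∈ Y, ∀ y ∈ Y, Relation.ReflTransGen (fun a b => GridAdj a b ∧ a ∈ Y ∧ b ∈ Y) x y

theorem single_one_add_self (x : ℤ × ℤ) :
    Finsupp.single x (1 : ZMod 2) + Finsupp.single x 1 = 0 := by
  rw [← Finsupp.single_add, CharTwo.add_self_eq_zero, Finsupp.single_zero]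

theorem GridConnected.exists_chain {Y : Set (ℤ × ℤ)} (hY : GridConnected Y) {x y : ℤ × ℤ}
    (hx : x ∈ Y) (hy : y ∈ Y) : ∃ w : GridEdge →₀ ZMod 2,
      gridBoundary w = Finsupp.single x 1 + Finsupp.single y 1 ∧
      ∀ e, w e ≠ 0 → src e ∈ Y ∧ tgt e ∈ Y := by
  have h := hY x hx y hy
  induction h with
  | refl =>
    refine ⟨0, ?_, by simp⟩
    rw [map_zero, single_one_add_self]
  | @tail b c _ hbc ih =>
    obtain ⟨⟨e, he⟩, hb, hc⟩ := hbc
    obtain ⟨w, hw, hw'⟩ := ih hb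
    refine ⟨w + Finsupp.single e 1, ?_, ?_⟩
    · rw [map_add, hw, gridBoundary, Finsupp.linearCombination_single, one_smul]
      have h1 := single_one_add_self b
      rcases he with ⟨h, h'⟩ | ⟨h, h'⟩ <;> rw [h, h']
      · rw [add_assoc, ← add_assoc (Finsupp.single b 1), h1, zero_add]
      · rw [add_assoc, add_comm (Finsupp.single c (1 : ZMod 2)), ← add_assoc (Finsupp.single b 1),
          h1, zero_add]
    · intro e' he'
      by_cases hee : e' = e
      · subst hee
        rcases he with ⟨h, h'⟩ | ⟨h, h'⟩ <;> rw [h, h']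
        exacts [⟨hb, hc⟩, ⟨hc, hb⟩]
      · apply hw'
        rwa [Finsupp.add_apply, Finsupp.single_eq_of_ne hee, add_zero] at he'

theorem exists_isDualPair_of_gridMinor {V E : Type*} [Fintype V] [Fintype E]
    (Y : V → Set (ℤ × ℤ)) (hfin : ∀ v, (Y v).Finite) (hdisj : ∀ u v x, x ∈ Y u → x ∈ Y v → u = v)
    (hconn : ∀ v, GridConnected (Y v)) (k : E → GridEdge) (hk : Function.Injective k)
    (p q : E → V) (hpq : ∀ e, p e ≠ q e)
    (hends : ∀ e, (src (k e) ∈ Y (p e) ∧ tgt (k e) ∈ Y (q e)) ∨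
      (src (k e) ∈ Y (q e) ∧ tgt (k e) ∈ Y (p e))) :
    ∃ (F : Type) (l r : E → F), IsDualPair p q l r := by
  classical
  let inner : Set GridEdge := {e | ∃ v, src e ∈ Y v ∧ tgt e ∈ Y v}
  have hk_inner : ∀ e, k e ∉ inner := by
    rintro e ⟨v, hs, ht⟩
    apply hpq e
    rcases hends e with ⟨h, h'⟩ | ⟨h, h'⟩
    · exact (hdisj _ _ _ h hs).trans (hdisj _ _ _ ht h')
    · exact (hdisj _ _ _ h' ht).trans (hdisj _ _ _ hs h)
  have hinner_fin : inner.Finite := by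
    have h1 : (⋃ v, Y v).Finite := Set.finite_iUnion hfin
    have h2 : ((fun x : (ℤ × ℤ) × Bool => ((x.1.1, x.1.2, x.2) : GridEdge)) ''
        ((⋃ v, Y v) ×ˢ Set.univ)).Finite := (h1.prod Set.finite_univ).image _
    refine h2.subset ?_
    rintro ⟨i, j, b⟩ ⟨v, hs, -⟩
    exact ⟨((i, j), b), ⟨Set.mem_iUnion.2 ⟨v, hs⟩, trivial⟩, rfl⟩
  let rel : ℤ × ℤ → ℤ × ℤ → Prop := fun a b =>
    ∃ e, e ∉ inner ∧ e ∉ Set.range k ∧ a = left e ∧ b = right e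
  refine ⟨Quot rel, fun e => Quot.mk _ (left (k e)), fun e => Quot.mk _ (right (k e)), ?_⟩
  intro z
  constructor
  · intro hz
    let b : V → ℤ × ℤ := fun v => if h : (Y v).Nonempty then h.some else 0
    have hb : ∀ v, (Y v).Nonempty → b v ∈ Y v := by
      intro v h
      simp only [b, dif_pos h]
      exact h.some_mem
    have hη : ∀ e, ∃ w : GridEdge →₀ ZMod 2,
        gridBoundary w = Finsupp.single (b (p e)) 1 + Finsupp.single (b (q e)) 1 ∧
        w (k e) = 1 ∧ ∀ e', e' ≠ k e → w e' ≠ 0 → e' ∈ inner := by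
      intro e
      obtain ⟨x, y, hx, hy, hxy⟩ : ∃ x y, x ∈ Y (p e) ∧ y ∈ Y (q e) ∧
          gridBoundary (Finsupp.single (k e) 1) = Finsupp.single x 1 + Finsupp.single y 1 := by
        simp only [gridBoundary, Finsupp.linearCombination_single, one_smul]
        rcases hends e with ⟨h, h'⟩ | ⟨h, h'⟩
        · exact ⟨_, _, h, h', rfl⟩
        · exact ⟨_, _, h', h, add_comm _ _⟩
      obtain ⟨w₁, h₁, h₁'⟩ := (hconn _).exists_chain (hb _ ⟨x, hx⟩) hx
      obtain ⟨w₂, h₂, h₂'⟩ := (hconn _).exists_chain (hb _ ⟨y, hy⟩) hy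
      have hw₁ : ∀ e', w₁ e' ≠ 0 → e' ∈ inner := fun e' h => ⟨_, h₁' e' h⟩
      have hw₂ : ∀ e', w₂ e' ≠ 0 → e' ∈ inner := fun e' h => ⟨_, h₂' e' h⟩
      refine ⟨w₁ + w₂ + Finsupp.single (k e) 1, ?_, ?_, ?_⟩
      · rw [map_add, map_add, h₁, h₂, hxy]
        have hx2 := single_one_add_self x
        have hy2 := single_one_add_self y
        calc _ = Finsupp.single (b (p e)) 1 + Finsupp.single (b (q e)) 1 +
              (Finsupp.single x (1 : ZMod 2) + Finsupp.single x (1 : ZMod 2)) +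
              (Finsupp.single y (1 : ZMod 2) + Finsupp.single y (1 : ZMod 2)) := by abel
          _ = _ := by rw [hx2, hy2, add_zero, add_zero]
      · have e₁ : w₁ (k e) = 0 := by
          by_contra h; exact hk_inner e (hw₁ _ h)
        have e₂ : w₂ (k e) = 0 := by
          by_contra h; exact hk_inner e (hw₂ _ h)
        simp [e₁, e₂]
      · intro e' hne h
        rw [Finsupp.add_apply, Finsupp.single_eq_of_ne hne, add_zero, Finsupp.add_apply] at h
        by_cases h1 : w₁ e' = 0
        · rw [h1, zero_add] at h
          exact hw₂ _ h
        · exact hw₁ _ h1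
    choose η hη₁ hη₂ hη₃ using hη
    let w : GridEdge →₀ ZMod 2 := ∑ e, z e • η e
    have hw : gridBoundary w = 0 := by
      ext x
      have := hz (fun v => if b v = x then 1 else 0)
      simp only [w, map_sum, map_smul, hη₁, Finsupp.finsetSum_apply, Finsupp.smul_apply,
        Finsupp.add_apply, Finsupp.single_apply, smul_eq_mul, Finsupp.coe_zero, Pi.zero_apply]
      exact this
    obtain ⟨φ, hφ⟩ := exists_potential_of_gridBoundary_eq_zero hw
    have hw_apply : ∀ e, w e = ∑ e', z e' * η e' e := by
      intro e
      simp [w, Finsupp.finsetSum_apply]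
    have hrel : ∀ a b, rel a b → φ a = φ b := by
      rintro _ _ ⟨e, hin, hr, rfl, rfl⟩
      have : w e = 0 := by
        rw [hw_apply]
        refine Finset.sum_eq_zero fun e' _ => ?_
        have : η e' e = 0 := by
          by_contra h
          exact hin (hη₃ e' e (fun h => hr ⟨e', h.symm⟩) h)
        rw [this, mul_zero]
      rw [hφ] at this
      exact CharTwo.add_eq_zero.1 this
    refine ⟨Quot.lift φ hrel, fun e => ?_⟩
    have : w (k e) = z e := by
      rw [hw_apply, Finset.sum_eq_single e]
      · rw [hη₂, mul_one]
      · intro e' _ hne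
        have : η e' (k e) = 0 := by
          by_contra h
          exact hk_inner e (hη₃ e' _ (fun h => hne (hk h).symm) h)
        rw [this, mul_zero]
      · simp
    rw [← this, hφ]
  · rintro ⟨φ', hφ'⟩ ψ'
    let φ : ℤ × ℤ → ZMod 2 := fun x => φ' (Quot.mk _ x)
    have hzero : ∀ e, e ∉ inner → e ∉ Set.range k → φ (left e) + φ (right e) = 0 := by
      intro e h h'
      have : φ (left e) = φ (right e) :=
        congrArg φ' (Quot.sound ⟨e, h, h', rfl, rfl⟩)
      rw [this, CharTwo.add_self_eq_zero]
    let w : GridEdge →₀ ZMod 2 := Finsupp.onFinset (hinner_fin.toFinset ∪ Finset.univ.image k)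
      (fun e => φ (left e) + φ (right e)) (by
        intro e he
        by_contra hcon
        simp only [Finset.mem_union, Set.Finite.mem_toFinset, Finset.mem_image, Finset.mem_univ,
          true_and, not_or] at hcon
        exact he (hzero e hcon.1 hcon.2))
    have hw : gridBoundary w = 0 := gridBoundary_eq_zero_of_potential (φ := φ) fun e => rfl
    let ψ : ℤ × ℤ → ZMod 2 := fun x => if h : ∃ v, x ∈ Y v then ψ' h.choose else 0
    have hψ : ∀ v x, x ∈ Y v → ψ x = ψ' v := by
      intro v x hx
      have h : ∃ v, x ∈ Y v := ⟨v, hx⟩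
      simp only [ψ, dif_pos h]
      rw [hdisj _ _ _ h.choose_spec hx]
    have h1 := sum_eq_zero_of_gridBoundary_eq_zero hw ψ
    rw [Finsupp.onFinset_sum _ (by simp), Finset.sum_union, Finset.sum_eq_zero, zero_add,
      Finset.sum_image (fun _ _ _ _ h => hk h)] at h1
    · rw [← h1]
      refine Finset.sum_congr rfl fun e _ => ?_
      rw [hφ']
      rcases hends e with ⟨h, h'⟩ | ⟨h, h'⟩
      · rw [hψ _ _ h, hψ _ _ h']
      · rw [hψ _ _ h, hψ _ _ h', add_comm (ψ' (q e))]
    · intro e he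
      obtain ⟨v, hs, ht⟩ := (Set.Finite.mem_toFinset _).1 he
      rw [hψ _ _ hs, hψ _ _ ht, CharTwo.add_self_eq_zero, mul_zero]
    · rw [Finset.disjoint_left]
      intro e he he'
      obtain ⟨e', -, rfl⟩ := Finset.mem_image.1 he'
      exact hk_inner e' ((Set.Finite.mem_toFinset _).1 he)

end Grid

section Discretization

theorem GridConnected.exists_isDualPair {V E : Type*} [Fintype V] [Fintype E]
    {B : V → Set (ℤ × ℤ)} {P : E → Set (ℤ × ℤ)} (hBfin : ∀ v, (B v).Finite)
    (hPfin : ∀ e, (P e).Finite) (hB : ∀ v, GridConnected (B v)) (hP : ∀ e, GridConnected (P e))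
    (hBB : ∀ u v x, x ∈ B u → x ∈ B v → u = v)
    (hPP : ∀ e e' x, x ∈ P e → x ∈ P e' → (∀ v, x ∉ B v) → e = e')
    {S T : E → Set V} (hST : ∀ e, Disjoint (S e) (T e))
    (hS : ∀ e, ∃ v ∈ S e, (P e ∩ B v).Nonempty) (hT : ∀ e, ∃ v ∈ T e, (P e ∩ B v).Nonempty)
    (hPB : ∀ e v, (P e ∩ B v).Nonempty → v ∈ S e ∪ T e)
    (hsimple : ∀ p q : E → V, (∀ e, p e ∈ S e) → (∀ e, q e ∈ T e) →
      Function.Injective fun e => s(p e, q e)) :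
    ∃ p q : E → V, (∀ e, p e ∈ S e) ∧ (∀ e, q e ∈ T e) ∧
      ∃ (F : Type) (l r : E → F), IsDualPair p q l r := by
  have hpath : ∀ e, ∃ v ∈ S e, ∃ w ∈ T e, ∃ a ∈ B v, ∃ b ∈ B w, ∃ c,
      Relation.ReflTransGen (fun g g' => GridAdj g g' ∧ g' ∈ P e ∧ ∀ v, g' ∉ B v) a c ∧
        GridAdj c b := by
    intro e
    obtain ⟨v, hv, x, hxP, hxB⟩ := hS e
    obtain ⟨w, hw, y, hyP, hyB⟩ := hT e
    have hxy := hP e x hxP y hyP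
    have hmain : (∃ w ∈ T e, x ∈ B w) ∨
        (∃ v ∈ S e, ∃ w ∈ T e, ∃ a ∈ B v, ∃ b ∈ B w, ∃ c,
        Relation.ReflTransGen (fun g g' => GridAdj g g' ∧ g' ∈ P e ∧ ∀ v, g' ∉ B v) a c ∧
          GridAdj c b) ∨ (∃ w ∈ T e, ∃ b ∈ B w, ∃ c,
        Relation.ReflTransGen (fun g g' => GridAdj g g' ∧ g' ∈ P e ∧ ∀ v, g' ∉ B v) x c ∧
          GridAdj c b) := by
      clear hxP hxB
      induction hxy using Relation.ReflTransGen.head_induction_on with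
      | refl => exact Or.inl ⟨w, hw, hyB⟩
      | @head x x₁ hstep _ ih =>
        obtain ⟨hadj, -, hx₁⟩ := hstep
        right
        rcases ih with ⟨w, hw, h⟩ | h | ⟨w, hw, b, hb, c, hc, hcb⟩
        · exact Or.inr ⟨w, hw, x₁, h, x, Relation.ReflTransGen.refl, hadj⟩
        · exact Or.inl h
        · by_cases hx : ∃ u, x₁ ∈ B u
          · obtain ⟨u, hu⟩ := hx
            rcases hPB e u ⟨x₁, hx₁, hu⟩ with hu' | hu'
            · exact Or.inl ⟨u, hu', w, hw, x₁, hu, b, hb, c, hc, hcb⟩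
            · exact Or.inr ⟨u, hu', x₁, hu, x, Relation.ReflTransGen.refl, hadj⟩
          · push Not at hx
            exact Or.inr ⟨w, hw, b, hb, c, Relation.ReflTransGen.head ⟨hadj, hx₁, hx⟩ hc, hcb⟩
    rcases hmain with ⟨w, hw, h⟩ | h | ⟨w, hw, b, hb, c, hc, hcb⟩
    · rw [hBB _ _ _ hxB h] at hv
      exact absurd hw (Set.disjoint_left.1 (hST e) hv)
    · exact h
    · exact ⟨v, hv, w, hw, x, hxB, b, hb, c, hc, hcb⟩
  choose p hp q hq a ha b hb c hc hcb using hpath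
  refine ⟨p, q, hp, hq, ?_⟩
  have hinj := hsimple p q hp hq
  let W : E → Set (ℤ × ℤ) := fun e => {g | Relation.ReflTransGen
    (fun g g' => GridAdj g g' ∧ g' ∈ P e ∧ ∀ v, g' ∉ B v) (a e) g}
  have hW : ∀ e g, g ∈ W e → g = a e ∨ (g ∈ P e ∧ ∀ v, g ∉ B v) := by
    intro e g hg
    rcases Relation.ReflTransGen.cases_tail hg with h | ⟨_, _, h⟩
    · exact Or.inl h
    · exact Or.inr h.2
  let Y : V → Set (ℤ × ℤ) := fun v => B v ∪ ⋃ e, ⋃ _ : p e = v, W e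
  have hWY : ∀ e, W e ⊆ Y (p e) := fun e g hg =>
    Or.inr (Set.mem_iUnion.2 ⟨e, Set.mem_iUnion.2 ⟨rfl, hg⟩⟩)
  have hY : ∀ v g, g ∈ Y v → g ∈ B v ∨ ∃ e, p e = v ∧ g ∈ P e ∧ ∀ u, g ∉ B u := by
    rintro v g (h | h)
    · exact Or.inl h
    · obtain ⟨e, h₁⟩ := Set.mem_iUnion.1 h
      obtain ⟨rfl, h₂⟩ := Set.mem_iUnion.1 h₁
      rcases hW e g h₂ with rfl | h'
      · exact Or.inl (ha e)
      · exact Or.inr ⟨e, rfl, h'⟩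
  have hYdisj : ∀ u v x, x ∈ Y u → x ∈ Y v → u = v := by
    intro u v x hu hv
    rcases hY _ _ hu with hu | ⟨e, rfl, hu, hu'⟩ <;> rcases hY _ _ hv with hv | ⟨e', rfl, hv, hv'⟩
    · exact hBB _ _ _ hu hv
    · exact absurd hu (hv' _)
    · exact absurd hv (hu' _)
    · rw [hPP _ _ _ hu hv hu']
  have hcY : ∀ e, c e ∈ Y (p e) := fun e => hWY e (hc e)
  have hbY : ∀ e, b e ∈ Y (q e) := fun e => Or.inl (hb e)
  choose k hk using hcb
  have hends : ∀ e, (GridEdge.src (k e) ∈ Y (p e) ∧ GridEdge.tgt (k e) ∈ Y (q e)) ∨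
      (GridEdge.src (k e) ∈ Y (q e) ∧ GridEdge.tgt (k e) ∈ Y (p e)) := by
    intro e
    rcases hk e with ⟨h, h'⟩ | ⟨h, h'⟩ <;> rw [h, h']
    · exact Or.inl ⟨hcY e, hbY e⟩
    · exact Or.inr ⟨hbY e, hcY e⟩
  refine exists_isDualPair_of_gridMinor Y ?_ hYdisj ?_ k ?_ p q ?_ hends
  · intro v
    refine ((hBfin v).union (Set.finite_iUnion hPfin)).subset ?_
    intro g hg
    rcases hY v g hg with h | ⟨e, -, h, -⟩
    · exact Or.inl h
    · exact Or.inr (Set.mem_iUnion.2 ⟨e, h⟩)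
  · intro v
    have hsymm : Std.Symm (fun g g' => GridAdj g g' ∧ g ∈ Y v ∧ g' ∈ Y v) :=
      ⟨fun g g' h => ⟨h.1.symm, h.2.2, h.2.1⟩⟩
    have hto : ∀ x ∈ Y v, ∃ x' ∈ B v, Relation.ReflTransGen
        (fun g g' => GridAdj g g' ∧ g ∈ Y v ∧ g' ∈ Y v) x' x := by
      rintro x (hx | hx)
      · exact ⟨x, hx, Relation.ReflTransGen.refl⟩
      · obtain ⟨e, hx₁⟩ := Set.mem_iUnion.1 hx
        obtain ⟨rfl, hx₂⟩ := Set.mem_iUnion.1 hx₁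
        refine ⟨a e, ha e, ?_⟩
        clear hx hx₁
        change Relation.ReflTransGen _ _ _ at hx₂
        induction hx₂ with
        | refl => exact Relation.ReflTransGen.refl
        | tail h1 h2 ih =>
          exact ih.tail ⟨h2.1, hWY e h1, hWY e (h1.tail h2)⟩
    intro x hx y hy
    obtain ⟨x', hx', hxx⟩ := hto x hx
    obtain ⟨y', hy', hyy⟩ := hto y hy
    have h1 : Relation.ReflTransGen
        (fun g g' => GridAdj g g' ∧ g ∈ Y v ∧ g' ∈ Y v) x' y' :=
      Relation.ReflTransGen.mono (fun g g' h => ⟨h.1, Or.inl h.2.1, Or.inl h.2.2⟩) _ _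
        (hB v x' hx' y' hy')
    exact ((Std.Symm.symm _ _ hxx).trans h1).trans hyy
  · intro e e' h
    apply hinj
    simp only [Sym2.eq_iff]
    rcases hends e with ⟨h1, h2⟩ | ⟨h1, h2⟩ <;> rcases hends e' with ⟨h3, h4⟩ | ⟨h3, h4⟩ <;>
      rw [← h] at h3 h4
    · exact Or.inl ⟨hYdisj _ _ _ h1 h3, hYdisj _ _ _ h2 h4⟩
    · exact Or.inr ⟨hYdisj _ _ _ h1 h3, hYdisj _ _ _ h2 h4⟩
    · exact Or.inr ⟨hYdisj _ _ _ h2 h4, hYdisj _ _ _ h1 h3⟩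
    · exact Or.inl ⟨hYdisj _ _ _ h2 h4, hYdisj _ _ _ h1 h3⟩
  · intro e h
    exact Set.disjoint_left.1 (hST e) (hp e) (h ▸ hq e)

theorem gridConnected_prod {A B : Set ℤ} (hA : A.OrdConnected) (hB : B.OrdConnected) :
    GridConnected (A ×ˢ B) := by
  have hsymm : Std.Symm (fun g g' => GridAdj g g' ∧ g ∈ A ×ˢ B ∧ g' ∈ A ×ˢ B) :=
    ⟨fun g g' h => ⟨h.1.symm, h.2.2, h.2.1⟩⟩
  have h1 : ∀ i ∈ A, ∀ i' ∈ A, i ≤ i' → ∀ j ∈ B, Relation.ReflTransGen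
      (fun g g' => GridAdj g g' ∧ g ∈ A ×ˢ B ∧ g' ∈ A ×ˢ B) (i, j) (i', j) := by
    intro i hi i' hi' hle j hj
    induction i', hle using Int.leInduction with
    | base => exact Relation.ReflTransGen.refl
    | succ n hn ih =>
      have hnA : n ∈ A := hA.out hi hi' ⟨hn, by omega⟩
      exact (ih hnA).tail ⟨⟨(n, j, false), Or.inl ⟨rfl, rfl⟩⟩, ⟨hnA, hj⟩, ⟨hi', hj⟩⟩
  have h2 : ∀ i ∈ A, ∀ j ∈ B, ∀ j' ∈ B, j ≤ j' → Relation.ReflTransGen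
      (fun g g' => GridAdj g g' ∧ g ∈ A ×ˢ B ∧ g' ∈ A ×ˢ B) (i, j) (i, j') := by
    intro i hi j hj j' hj' hle
    induction j', hle using Int.leInduction with
    | base => exact Relation.ReflTransGen.refl
    | succ n hn ih =>
      have hnB : n ∈ B := hB.out hj hj' ⟨hn, by omega⟩
      exact (ih hnB).tail ⟨⟨(i, n, true), Or.inl ⟨rfl, rfl⟩⟩, ⟨hi, hnB⟩, ⟨hi, hj'⟩⟩
  rintro ⟨i, j⟩ ⟨hi, hj⟩ ⟨i', j'⟩ ⟨hi', hj'⟩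
  refine Relation.ReflTransGen.trans (b := (i', j)) ?_ ?_
  · rcases le_total i i' with h | h
    · exact h1 i hi i' hi' h j hj
    · exact Std.Symm.symm _ _ (h1 i' hi' i hi h j hj)
  · rcases le_total j j' with h | h
    · exact h2 i' hi' j hj j' hj' h
    · exact Std.Symm.symm _ _ (h2 i' hi' j' hj' j hj h)

/-- The point of the grid of mesh `η` with the given index. -/
def gridPoint (η : ℝ) (g : ℤ × ℤ) : Pt := (η * g.1, η * g.2)

/-- The indices of the points of the grid of mesh `η` at distance less than `ρ` from `K`. -/
def gridNhd (η ρ : ℝ) (K : Set Pt) : Set (ℤ × ℤ) := {g | ∃ x ∈ K, dist (gridPoint η g) x < ρ}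

theorem exists_gridPoint_dist_lt {η : ℝ} (hη : 0 < η) (x : Pt) :
    ∃ g, dist (gridPoint η g) x < η := by
  refine ⟨(⌊x.1 / η⌋, ⌊x.2 / η⌋), ?_⟩
  have key : ∀ t : ℝ, dist (η * (⌊t / η⌋ : ℤ)) t < η := by
    intro t
    have h1 := Int.floor_le (t / η)
    have h2 := Int.lt_floor_add_one (t / η)
    rw [le_div_iff₀ hη] at h1
    rw [div_lt_iff₀ hη] at h2
    rw [Real.dist_eq, abs_lt]
    constructor <;> linarith
  rw [Prod.dist_eq]
  exact max_lt (key _) (key _)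

theorem gridConnected_gridNhd {η ρ : ℝ} (hη : 0 < η) (hρ : η ≤ ρ) {K : Set Pt}
    (hK : IsPreconnected K) : GridConnected (gridNhd η ρ K) := by
  have hblock : ∀ x, GridConnected {g | dist (gridPoint η g) x < ρ} := by
    intro x
    have hord : ∀ t : ℝ, {i : ℤ | dist (η * i) t < ρ}.OrdConnected := by
      intro t
      refine ⟨fun i hi j hj k hk => ?_⟩
      simp only [Set.mem_ofPred_eq, Real.dist_eq, abs_lt] at hi hj ⊢
      have h1 : η * i ≤ η * k := mul_le_mul_of_nonneg_left (by exact_mod_cast hk.1) hη.le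
      have h2 : η * k ≤ η * j := mul_le_mul_of_nonneg_left (by exact_mod_cast hk.2) hη.le
      constructor <;> linarith
    have : {g | dist (gridPoint η g) x < ρ} =
        {i : ℤ | dist (η * i) x.1 < ρ} ×ˢ {i : ℤ | dist (η * i) x.2 < ρ} := by
      ext g
      simp [gridPoint, Prod.dist_eq]
    rw [this]
    exact gridConnected_prod (hord _) (hord _)
  intro g hg g' hg'
  by_contra hcon
  let R : Set (ℤ × ℤ) := {h | Relation.ReflTransGen
    (fun a b => GridAdj a b ∧ a ∈ gridNhd η ρ K ∧ b ∈ gridNhd η ρ K) g h}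
  have hopen : ∀ A : Set (ℤ × ℤ), IsOpen (⋃ h ∈ A, Metric.ball (gridPoint η h) ρ) :=
    fun A => isOpen_biUnion fun _ _ => Metric.isOpen_ball
  obtain ⟨x, hx, hxR, hxR'⟩ := hK (⋃ h ∈ R, Metric.ball (gridPoint η h) ρ)
    (⋃ h ∈ Rᶜ, Metric.ball (gridPoint η h) ρ) (hopen _) (hopen _) (by
      intro x _
      obtain ⟨h, hh⟩ := exists_gridPoint_dist_lt hη x
      have hmem : x ∈ Metric.ball (gridPoint η h) ρ := by
        rw [Metric.mem_ball']; exact hh.trans_le hρ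
      by_cases hR : h ∈ R
      · exact Or.inl (Set.mem_biUnion hR hmem)
      · exact Or.inr (Set.mem_biUnion (show h ∈ Rᶜ from hR) hmem))
    (by
      obtain ⟨x, hx, hd⟩ := hg
      refine ⟨x, hx, Set.mem_biUnion (x := g) Relation.ReflTransGen.refl ?_⟩
      rw [Metric.mem_ball']; exact hd)
    (by
      obtain ⟨x, hx, hd⟩ := hg'
      refine ⟨x, hx, Set.mem_biUnion (x := g') hcon ?_⟩
      rw [Metric.mem_ball']; exact hd)
  simp only [Set.mem_iUnion, Metric.mem_ball', exists_prop] at hxR hxR'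
  obtain ⟨h, hh, hd⟩ := hxR
  obtain ⟨h', hh', hd'⟩ := hxR'
  apply hh'
  refine Relation.ReflTransGen.trans hh (Relation.ReflTransGen.mono ?_ _ _ (hblock x h hd h' hd'))
  rintro a b ⟨hab, ha, hb⟩
  exact ⟨hab, ⟨x, hx, ha⟩, ⟨x, hx, hb⟩⟩

theorem finite_gridNhd {η : ℝ} (hη : 0 < η) (ρ : ℝ) {K : Set Pt} (hK : Bornology.IsBounded K) :
    (gridNhd η ρ K).Finite := by
  obtain ⟨R, hR⟩ := hK.subset_closedBall 0
  let n : ℤ := ⌈(R + ρ) / η⌉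
  refine ((Set.finite_Icc (-n) n).prod (Set.finite_Icc (-n) n)).subset ?_
  rintro g ⟨x, hx, hd⟩
  have h1 := hR hx
  rw [Metric.mem_closedBall] at h1
  have h2 : dist (gridPoint η g) 0 ≤ R + ρ := by
    have := dist_triangle (gridPoint η g) x 0
    linarith
  have key : ∀ i : ℤ, dist (η * i) 0 ≤ R + ρ → i ∈ Set.Icc (-n) n := by
    intro i hi
    rw [Real.dist_eq, sub_zero, abs_le] at hi
    have h3 : (R + ρ) / η ≤ n := Int.le_ceil _
    rw [div_le_iff₀ hη] at h3
    constructor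
    · have : (-n : ℝ) ≤ i := by nlinarith
      exact_mod_cast this
    · have : (i : ℝ) ≤ n := by nlinarith
      exact_mod_cast this
  rw [Prod.dist_eq, max_le_iff] at h2
  exact ⟨key _ h2.1, key _ h2.2⟩

open Filter Topology in
theorem eventually_forall_lt_dist {X Y : Set Pt} (hX : IsCompact X) (hY : IsCompact Y)
    (h : Disjoint X Y) : ∀ᶠ ε in 𝓝[>] (0 : ℝ), ∀ x ∈ X, ∀ y ∈ Y, ε < dist x y := by
  obtain ⟨δ, hδ, hd⟩ := h.exists_thickenings hX hY.isClosed
  filter_upwards [Ioo_mem_nhdsGT hδ] with ε hε x hx y hy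
  by_contra! hle
  have hy₁ : y ∈ Metric.thickening δ X :=
    Metric.mem_thickening_iff.2 ⟨x, hx, by rw [dist_comm]; exact hle.trans_lt hε.2⟩
  exact Set.disjoint_left.1 hd hy₁ (Metric.self_subset_thickening hδ _ hy)

open Filter Topology in
/-- Contracting the compact connected sets `K v` and keeping the connected sets `a e` as edges
yields a planar graph, witnessed by a dual pair. -/
theorem exists_isDualPair_of_isPreconnected {V E : Type*} [Fintype V] [Fintype E]
    {K : V → Set Pt} {a : E → Set Pt} (hKc : ∀ v, IsCompact (K v))
    (hKp : ∀ v, IsPreconnected (K v)) (hac : ∀ e, IsCompact (a e))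
    (hap : ∀ e, IsPreconnected (a e)) (hKK : ∀ u v, u ≠ v → Disjoint (K u) (K v))
    (haa : ∀ e e', e ≠ e' → a e ∩ a e' ⊆ ⋃ v, K v)
    {S T : E → Set V} (hST : ∀ e, Disjoint (S e) (T e))
    (hS : ∀ e, ∃ v ∈ S e, (a e ∩ K v).Nonempty) (hT : ∀ e, ∃ v ∈ T e, (a e ∩ K v).Nonempty)
    (haK : ∀ e v, (a e ∩ K v).Nonempty → v ∈ S e ∪ T e)
    (hsimple : ∀ p q : E → V, (∀ e, p e ∈ S e) → (∀ e, q e ∈ T e) →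
      Function.Injective fun e => s(p e, q e)) :
    ∃ p q : E → V, (∀ e, p e ∈ S e) ∧ (∀ e, q e ∈ T e) ∧
      ∃ (F : Type) (l r : E → F), IsDualPair p q l r := by
  have h1 : ∀ᶠ ε in 𝓝[>] (0 : ℝ), ∀ u v, u ≠ v → ∀ x ∈ K u, ∀ y ∈ K v, ε < dist x y := by
    rw [eventually_all]; intro u
    rw [eventually_all]; intro v
    by_cases huv : u = v
    · exact Eventually.of_forall fun ε h => absurd huv h
    · filter_upwards [eventually_forall_lt_dist (hKc u) (hKc v) (hKK u v huv)] with ε h _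
      exact h
  have h2 : ∀ᶠ ε in 𝓝[>] (0 : ℝ), ∀ e v, v ∉ S e ∪ T e → ∀ x ∈ a e, ∀ y ∈ K v, ε < dist x y := by
    rw [eventually_all]; intro e
    rw [eventually_all]; intro v
    by_cases hev : v ∈ S e ∪ T e
    · exact Eventually.of_forall fun ε h => absurd hev h
    · have : Disjoint (a e) (K v) := by
        rw [Set.disjoint_iff_inter_eq_empty, ← Set.not_nonempty_iff_eq_empty]
        exact fun h => hev (haK e v h)
      filter_upwards [eventually_forall_lt_dist (hac e) (hKc v) this] with ε h _
      exact h
  obtain ⟨ε, ⟨h1, h2⟩, hε⟩ := ((h1.and h2).and self_mem_nhdsWithin).exists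
  let a' : E → Set Pt := fun e => a e \ ⋃ v, Metric.thickening (ε / 5) (K v)
  have ha'c : ∀ e, IsCompact (a' e) := fun e =>
    (hac e).diff (isOpen_iUnion fun v => Metric.isOpen_thickening)
  have h3 : ∀ᶠ δ in 𝓝[>] (0 : ℝ), ∀ e e', e ≠ e' → ∀ x ∈ a' e, ∀ y ∈ a' e', δ < dist x y := by
    rw [eventually_all]; intro e
    rw [eventually_all]; intro e'
    by_cases hee : e = e'
    · exact Eventually.of_forall fun ε h => absurd hee h
    · have : Disjoint (a' e) (a' e') := by
        rw [Set.disjoint_left]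
        rintro x ⟨hx, hx'⟩ ⟨hy, -⟩
        obtain ⟨v, hv⟩ := Set.mem_iUnion.1 (haa e e' hee ⟨hx, hy⟩)
        exact hx' (Set.mem_iUnion.2 ⟨v, Metric.self_subset_thickening (by linarith) _ hv⟩)
      filter_upwards [eventually_forall_lt_dist (ha'c e) (ha'c e') this] with ε h _
      exact h
  obtain ⟨δ, ⟨h3, hδε⟩, hδ⟩ :=
    ((h3.and (Ioo_mem_nhdsGT (show (0 : ℝ) < ε / 5 by linarith))).and self_mem_nhdsWithin).exists
  have hδε := hδε.2
  let η := δ / 2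
  have hη : 0 < η := by simp only [η]; linarith
  have hηδ : η + η = δ := by simp only [η]; ring
  have hmeet : ∀ e v, (a e ∩ K v).Nonempty →
      (gridNhd η η (a e) ∩ gridNhd η (2 * (ε / 5)) (K v)).Nonempty := by
    rintro e v ⟨x, hx, hx'⟩
    obtain ⟨g, hg⟩ := exists_gridPoint_dist_lt hη x
    exact ⟨g, ⟨x, hx, hg⟩, ⟨x, hx', by linarith⟩⟩
  refine GridConnected.exists_isDualPair (B := fun v => gridNhd η (2 * (ε / 5)) (K v))
    (P := fun e => gridNhd η η (a e)) (fun v => finite_gridNhd hη _ (hKc v).isBounded)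
    (fun e => finite_gridNhd hη _ (hac e).isBounded)
    (fun v => gridConnected_gridNhd hη (by linarith) (hKp v))
    (fun e => gridConnected_gridNhd hη le_rfl (hap e)) ?_ ?_ hST ?_ ?_ ?_ hsimple
  · rintro u v g ⟨x, hx, hd⟩ ⟨y, hy, hd'⟩
    by_contra huv
    have h4 := h1 u v huv x hx y hy
    have h5 := dist_triangle_left x y (gridPoint η g)
    linarith
  · rintro e e' g ⟨x, hx, hd⟩ ⟨y, hy, hd'⟩ hg
    by_contra hee
    have hout : ∀ x, dist (gridPoint η g) x < η → x ∉ ⋃ v, Metric.thickening (ε / 5) (K v) := by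
      intro x hd hx
      obtain ⟨v, hv⟩ := Set.mem_iUnion.1 hx
      obtain ⟨z, hz, hxz⟩ := Metric.mem_thickening_iff.1 hv
      refine hg v ⟨z, hz, ?_⟩
      have := dist_triangle (gridPoint η g) x z
      linarith
    have h4 := h3 e e' hee x ⟨hx, hout x hd⟩ y ⟨hy, hout y hd'⟩
    have h5 := dist_triangle_left x y (gridPoint η g)
    linarith
  · intro e
    obtain ⟨v, hv, h⟩ := hS e
    exact ⟨v, hv, hmeet e v h⟩
  · intro e
    obtain ⟨v, hv, h⟩ := hT e
    exact ⟨v, hv, hmeet e v h⟩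
  · rintro e v ⟨g, ⟨x, hx, hd⟩, ⟨y, hy, hd'⟩⟩
    by_contra hev
    have h4 := h2 e v hev x hx y hy
    have h5 := dist_triangle_left x y (gridPoint η g)
    linarith

theorem exists_isDualPair_of_ends {V E : Type*} [Fintype V] [Fintype E]
    {K : V → Set Pt} {a : E → Set Pt} (hKc : ∀ v, IsCompact (K v))
    (hKp : ∀ v, IsPreconnected (K v)) (hac : ∀ e, IsCompact (a e))
    (hap : ∀ e, IsPreconnected (a e)) (hKK : ∀ u v, u ≠ v → Disjoint (K u) (K v))
    (haa : ∀ e e', e ≠ e' → a e ∩ a e' ⊆ ⋃ v, K v) {p q : E → V} (hpq : ∀ e, p e ≠ q e)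
    (hp : ∀ e, (a e ∩ K (p e)).Nonempty) (hq : ∀ e, (a e ∩ K (q e)).Nonempty)
    (haK : ∀ e v, (a e ∩ K v).Nonempty → v = p e ∨ v = q e)
    (hsimple : Function.Injective fun e => s(p e, q e)) :
    ∃ (F : Type) (l r : E → F), IsDualPair p q l r := by
  obtain ⟨p', q', hp', hq', h⟩ := exists_isDualPair_of_isPreconnected (S := fun e => {p e})
    (T := fun e => {q e}) hKc hKp hac hap hKK haa
    (fun e => Set.disjoint_singleton.2 (hpq e)) (fun e => ⟨_, rfl, hp e⟩)
    (fun e => ⟨_, rfl, hq e⟩) haK (fun p' q' hp' hq' => by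
      obtain rfl : p' = p := funext hp'
      obtain rfl : q' = q := funext hq'
      exact hsimple)
  obtain rfl : p' = p := funext hp'
  obtain rfl : q' = q := funext hq'
  exact h

end Discretization

section Mixed

theorem IsPathConnected.exists_isCompact_isPreconnected {X ι : Type*} [TopologicalSpace X]
    [Finite ι] {F : Set X} (hF : IsPathConnected F) {p : ι → X} (hp : ∀ i, p i ∈ F) :
    ∃ T ⊆ F, IsCompact T ∧ IsPreconnected T ∧ ∀ i, p i ∈ T := by
  obtain ⟨x, hx, hxF⟩ := hF
  refine ⟨⋃ i, Set.range (hxF (hp i)).somePath, ?_, ?_, ?_, ?_⟩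
  · refine Set.iUnion_subset fun i => ?_
    rintro _ ⟨t, rfl⟩
    exact (hxF (hp i)).somePath_mem t
  · exact isCompact_iUnion fun i => isCompact_range (hxF (hp i)).somePath.continuous
  · refine isPreconnected_iUnion ⟨x, Set.mem_iInter.2 fun i => ?_⟩ fun i =>
      isPreconnected_range (hxF (hp i)).somePath.continuous
    exact ⟨0, (hxF (hp i)).somePath.source⟩
  · intro i
    exact Set.mem_iUnion.2 ⟨i, 1, (hxF (hp i)).somePath.target⟩

/-- Pairwise disjoint pieces of curves (the rows), pairwise disjoint connected sets meeting each
row at most once (the columns), and pairwise disjoint curves, each meeting exactly one row and one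
column and reaching the connected open set `F` from its row. -/
structure RowColumn (I J E : Type*) where
  /-- a parametrization of each row -/
  γ : I → ℝ → Pt
  /-- the range of the parameter on each row -/
  R : I → Set ℝ
  /-- the columns -/
  L : J → Set Pt
  /-- the row met by a curve -/
  row : E → I
  /-- the column met by a curve -/
  col : E → J
  /-- the parameter of a point where a curve meets its row -/
  t : E → ℝ
  /-- the curves -/
  c : E → Set Pt
  /-- the part of a curve leading from its row to `F` -/
  σ : E → Set Pt
  /-- the common open set reached by the curves -/
  F : Set Pt
  continuous_γ : ∀ i, Continuous (γ i)
  injective_γ : ∀ i, Function.Injective (γ i)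
  ordConnected_R : ∀ i, (R i).OrdConnected
  disjoint_row : ∀ i i', i ≠ i' → Disjoint (γ i '' R i) (γ i' '' R i')
  isCompact_L : ∀ j, IsCompact (L j)
  isPreconnected_L : ∀ j, IsPreconnected (L j)
  disjoint_L : ∀ j j', j ≠ j' → Disjoint (L j) (L j')
  subsingleton_cross : ∀ i j, {s ∈ R i | γ i s ∈ L j}.Subsingleton
  injective_row_col : ∀ e e', row e = row e' → col e = col e' → e = e'
  t_mem : ∀ e, t e ∈ R (row e)
  t_notMem : ∀ e j, γ (row e) (t e) ∉ L j
  isCompact_c : ∀ e, IsCompact (c e)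
  isPreconnected_c : ∀ e, IsPreconnected (c e)
  disjoint_c : ∀ e e', e ≠ e' → Disjoint (c e) (c e')
  c_inter_col : ∀ e, (c e ∩ L (col e)).Nonempty
  eq_col : ∀ e j, (c e ∩ L j).Nonempty → j = col e
  t_mem_c : ∀ e, γ (row e) (t e) ∈ c e
  eq_row : ∀ e i, (c e ∩ γ i '' R i).Nonempty → i = row e
  isOpen_F : IsOpen F
  isConnected_F : IsConnected F
  disjoint_F_row : ∀ i, Disjoint F (γ i '' R i)
  disjoint_F_L : ∀ j, Disjoint F (L j)
  isCompact_σ : ∀ e, IsCompact (σ e)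
  isPreconnected_σ : ∀ e, IsPreconnected (σ e)
  σ_subset_c : ∀ e, σ e ⊆ c e
  t_mem_σ : ∀ e, γ (row e) (t e) ∈ σ e
  σ_inter_F : ∀ e, (σ e ∩ F).Nonempty
  σ_subset : ∀ e, σ e ⊆ F ∪ {γ (row e) (t e)}

namespace RowColumn

variable {I J E : Type*} [Fintype J] (X : RowColumn I J E)

open Classical in
/-- The columns crossing the row `i` before the parameter `s`. -/
noncomputable def before (i : I) (s : ℝ) : Finset J :=
  {j | ∃ s' ∈ X.R i, s' < s ∧ X.γ i s' ∈ X.L j}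

theorem mem_before {i : I} {s : ℝ} {j : J} :
    j ∈ X.before i s ↔ ∃ s' ∈ X.R i, s' < s ∧ X.γ i s' ∈ X.L j := by
  simp [before]

theorem before_mono (i : I) {s s' : ℝ} (h : s ≤ s') : X.before i s ⊆ X.before i s' := by
  intro j
  simp only [mem_before]
  rintro ⟨u, hu, hus, huj⟩
  exact ⟨u, hu, hus.trans_le h, huj⟩

/-- The piece of a row containing the distinguished point of a curve. -/
noncomputable def piece (e : E) : I × Finset J := (X.row e, X.before (X.row e) (X.t e))

theorem exists_bounds [Finite E] (x : Set.range X.piece) : ∃ lo hi : E, X.piece lo = x ∧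
    X.piece hi = x ∧ ∀ e, X.piece e = x → X.t lo ≤ X.t e ∧ X.t e ≤ X.t hi := by
  have hne : {e | X.piece e = x}.Nonempty := x.2
  obtain ⟨lo, hlo, h⟩ := Set.exists_min_image _ X.t (Set.toFinite _) hne
  obtain ⟨hi, hhi, h'⟩ := Set.exists_max_image _ X.t (Set.toFinite _) hne
  exact ⟨lo, hi, hlo, hhi, fun e he => ⟨h e he, h' e he⟩⟩

variable [Finite E]

/-- The curve meeting a piece first. -/
noncomputable def lo (x : Set.range X.piece) : E := (X.exists_bounds x).choose

/-- The curve meeting a piece last. -/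
noncomputable def hi (x : Set.range X.piece) : E := (X.exists_bounds x).choose_spec.choose

theorem piece_lo (x : Set.range X.piece) : X.piece (X.lo x) = x :=
  (X.exists_bounds x).choose_spec.choose_spec.1

theorem piece_hi (x : Set.range X.piece) : X.piece (X.hi x) = x :=
  (X.exists_bounds x).choose_spec.choose_spec.2.1

theorem t_lo_le {x : Set.range X.piece} {e : E} (h : X.piece e = x) : X.t (X.lo x) ≤ X.t e :=
  ((X.exists_bounds x).choose_spec.choose_spec.2.2 e h).1

theorem le_t_hi {x : Set.range X.piece} {e : E} (h : X.piece e = x) : X.t e ≤ X.t (X.hi x) :=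
  ((X.exists_bounds x).choose_spec.choose_spec.2.2 e h).2

theorem row_lo (x : Set.range X.piece) : X.row (X.lo x) = x.1.1 :=
  congrArg Prod.fst (X.piece_lo x)

theorem row_hi (x : Set.range X.piece) : X.row (X.hi x) = x.1.1 :=
  congrArg Prod.fst (X.piece_hi x)

theorem before_lo (x : Set.range X.piece) : X.before x.1.1 (X.t (X.lo x)) = x.1.2 := by
  rw [← row_lo]; exact congrArg Prod.snd (X.piece_lo x)

theorem before_hi (x : Set.range X.piece) : X.before x.1.1 (X.t (X.hi x)) = x.1.2 := by
  rw [← row_hi]; exact congrArg Prod.snd (X.piece_hi x)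

theorem lo_mem (x : Set.range X.piece) : X.t (X.lo x) ∈ X.R x.1.1 := by
  rw [← row_lo]; exact X.t_mem _

theorem hi_mem (x : Set.range X.piece) : X.t (X.hi x) ∈ X.R x.1.1 := by
  rw [← row_hi]; exact X.t_mem _

theorem lo_notMem (x : Set.range X.piece) (j : J) : X.γ x.1.1 (X.t (X.lo x)) ∉ X.L j := by
  rw [← row_lo]; exact X.t_notMem _ j

theorem hi_notMem (x : Set.range X.piece) (j : J) : X.γ x.1.1 (X.t (X.hi x)) ∉ X.L j := by
  rw [← row_hi]; exact X.t_notMem _ j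

theorem lo_le_hi (x : Set.range X.piece) : X.t (X.lo x) ≤ X.t (X.hi x) :=
  X.le_t_hi (X.piece_lo x)

/-- The points of a piece. -/
noncomputable def pieceSet (x : Set.range X.piece) : Set Pt :=
  X.γ x.1.1 '' Set.Icc (X.t (X.lo x)) (X.t (X.hi x))

theorem t_mem_pieceSet (e : E) :
    X.γ (X.row e) (X.t e) ∈ X.pieceSet ⟨X.piece e, Set.mem_range_self e⟩ :=
  ⟨X.t e, ⟨X.t_lo_le rfl, X.le_t_hi rfl⟩, rfl⟩

theorem mem_R_of_mem_Icc {x : Set.range X.piece} {s : ℝ}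
    (hs : s ∈ Set.Icc (X.t (X.lo x)) (X.t (X.hi x))) : s ∈ X.R x.1.1 :=
  (X.ordConnected_R _).out (X.lo_mem x) (X.hi_mem x) hs

theorem pieceSet_subset (x : Set.range X.piece) : X.pieceSet x ⊆ X.γ x.1.1 '' X.R x.1.1 :=
  Set.image_mono fun _ => X.mem_R_of_mem_Icc

theorem before_of_mem_Icc {x : Set.range X.piece} {s : ℝ}
    (hs : s ∈ Set.Icc (X.t (X.lo x)) (X.t (X.hi x))) : X.before x.1.1 s = x.1.2 :=
  ((X.before_mono _ hs.2).trans (X.before_hi x).subset).antisymm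
    ((X.before_lo x).symm.subset.trans (X.before_mono _ hs.1))

theorem disjoint_pieceSet_L (x : Set.range X.piece) (j : J) :
    Disjoint (X.pieceSet x) (X.L j) := by
  rw [Set.disjoint_left]
  rintro _ ⟨s, hs, rfl⟩ hj
  have hsR := X.mem_R_of_mem_Icc hs
  have hlt : s < X.t (X.hi x) := lt_of_le_of_ne hs.2 fun h => X.hi_notMem x j (h ▸ hj)
  have h1 : j ∈ X.before x.1.1 (X.t (X.lo x)) := by
    rw [before_lo, ← before_hi]
    exact X.mem_before.2 ⟨s, hsR, hlt, hj⟩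
  obtain ⟨s', hs', hlt', hj'⟩ := X.mem_before.1 h1
  have := X.subsingleton_cross x.1.1 j ⟨hsR, hj⟩ ⟨hs', hj'⟩
  have := hs.1
  linarith

omit [Fintype J] [Finite E] in
theorem eq_of_mem_rows {i i' : I} {s s' : ℝ} (hs : s ∈ X.R i) (hs' : s' ∈ X.R i')
    (h : X.γ i s = X.γ i' s') : i = i' ∧ s = s' := by
  have hi : i = i' := by
    by_contra hne
    exact Set.disjoint_left.1 (X.disjoint_row i i' hne) ⟨s, hs, rfl⟩ ⟨s', hs', h.symm⟩
  subst hi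
  exact ⟨rfl, X.injective_γ i h⟩

theorem eq_of_mem_pieceSet {x y : Set.range X.piece} {s : ℝ} (hs : s ∈ X.R x.1.1)
    (hb : X.before x.1.1 s = x.1.2) (hy : X.γ x.1.1 s ∈ X.pieceSet y) : x = y := by
  obtain ⟨s', hs', h⟩ := hy
  obtain ⟨h1, rfl⟩ := X.eq_of_mem_rows (X.mem_R_of_mem_Icc hs') hs h
  refine Subtype.ext (Prod.ext h1.symm ?_)
  rw [← hb, ← h1, X.before_of_mem_Icc hs']

theorem disjoint_pieceSet {x y : Set.range X.piece} (h : x ≠ y) :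
    Disjoint (X.pieceSet x) (X.pieceSet y) := by
  rw [Set.disjoint_left]
  rintro _ ⟨s, hs, rfl⟩ hy
  exact h (X.eq_of_mem_pieceSet (X.mem_R_of_mem_Icc hs) (X.before_of_mem_Icc hs) hy)

theorem isCompact_pieceSet (x : Set.range X.piece) : IsCompact (X.pieceSet x) :=
  isCompact_Icc.image (X.continuous_γ _)

theorem isPreconnected_pieceSet (x : Set.range X.piece) : IsPreconnected (X.pieceSet x) :=
  isPreconnected_Icc.image _ (X.continuous_γ _).continuousOn

theorem card_curves [Fintype E] [Fintype (Set.range X.piece)] : Fintype.card E = 0 ∨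
    Fintype.card E + 1 ≤ Fintype.card (Set.range X.piece) + Fintype.card J ∨
    Fintype.card E + 4 ≤ 2 * (Fintype.card (Set.range X.piece) + Fintype.card J) := by
  let S : E → Set (Set.range X.piece ⊕ J) := fun e => {u | ∃ x, x.1.1 = X.row e ∧ u = Sum.inl x}
  let T : E → Set (Set.range X.piece ⊕ J) := fun e => {Sum.inr (X.col e)}
  have hsimple : ∀ p q : E → Set.range X.piece ⊕ J, (∀ e, p e ∈ S e) → (∀ e, q e ∈ T e) →
      Function.Injective fun e => s(p e, q e) := by
    intro p q hp hq e e' h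
    obtain ⟨x, hx, hpe⟩ := hp e
    obtain ⟨x', hx', hpe'⟩ := hp e'
    simp only [hpe, hpe', show q e = _ from hq e, show q e' = _ from hq e', Sym2.eq_iff,
      Sum.inl.injEq, Sum.inr.injEq, reduceCtorEq, and_self, or_false] at h
    exact X.injective_row_col e e' (by rw [← hx, ← hx', h.1]) h.2
  obtain ⟨p, q, hp, hq, F, l, r, h⟩ := exists_isDualPair_of_isPreconnected
    (K := Sum.elim X.pieceSet X.L) (a := X.c)
    (S := S) (T := T)
    (by rintro (x | j); exacts [X.isCompact_pieceSet x, X.isCompact_L j])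
    (by rintro (x | j); exacts [X.isPreconnected_pieceSet x, X.isPreconnected_L j])
    X.isCompact_c X.isPreconnected_c
    (by
      rintro (x | j) (y | k) h
      · exact X.disjoint_pieceSet fun hxy => h (hxy ▸ rfl)
      · exact X.disjoint_pieceSet_L x k
      · exact (X.disjoint_pieceSet_L y j).symm
      · exact X.disjoint_L j k fun hjk => h (hjk ▸ rfl))
    (fun e e' h => by
      rw [Set.disjoint_iff_inter_eq_empty.1 (X.disjoint_c e e' h)]
      exact Set.empty_subset _)
    (fun e => by
      rw [Set.disjoint_singleton_right]
      rintro ⟨x, -, h⟩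
      cases h)
    (fun e => ⟨_, ⟨⟨X.piece e, Set.mem_range_self e⟩, rfl, rfl⟩, _, X.t_mem_c e,
      X.t_mem_pieceSet e⟩)
    (fun e => ⟨_, rfl, X.c_inter_col e⟩)
    (by
      rintro e (x | j) ⟨z, hz, hz'⟩
      · exact Or.inl ⟨x, X.eq_row e _ ⟨z, hz, X.pieceSet_subset x hz'⟩, rfl⟩
      · exact Or.inr (congrArg Sum.inr (X.eq_col e j ⟨z, hz, hz'⟩)))
    hsimple
  have := card_le_of_isDualPair_of_bipartite h (side := fun u => u.isLeft)
    (fun e => by obtain ⟨x, -, hx⟩ := hp e; rw [hx]; rfl)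
    (fun e => by rw [show q e = _ from hq e]; simp)
    (hsimple p q hp hq)
  rwa [Fintype.card_sum] at this

omit [Finite E] in
theorem finite_cross (i : I) : {s ∈ X.R i | ∃ j, X.γ i s ∈ X.L j}.Finite := by
  have : {s ∈ X.R i | ∃ j, X.γ i s ∈ X.L j} = ⋃ j, {s ∈ X.R i | X.γ i s ∈ X.L j} := by
    ext s; simp
  rw [this]
  exact Set.finite_iUnion fun j => (X.subsingleton_cross i j).finite

theorem exists_left {x : Set.range X.piece} (hx : x.1.2.Nonempty) :
    ∃ u ∈ X.R x.1.1, u < X.t (X.lo x) ∧ ∃ j, X.γ x.1.1 u ∈ X.L j ∧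
      ∀ s, u < s → s ≤ X.t (X.lo x) →
        X.before x.1.1 s = x.1.2 ∧ ∀ j, X.γ x.1.1 s ∉ X.L j := by
  obtain ⟨j, hj⟩ := hx
  rw [← before_lo, mem_before] at hj
  obtain ⟨s, hsR, hs, hj⟩ := hj
  obtain ⟨u, ⟨⟨huR, j', hu⟩, hlt⟩, hmax⟩ := Set.exists_max_image
    ({s ∈ X.R x.1.1 | ∃ j, X.γ x.1.1 s ∈ X.L j} ∩ Set.Iio (X.t (X.lo x))) id
    ((X.finite_cross _).inter_of_left _) ⟨s, ⟨hsR, j, hj⟩, hs⟩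
  have hno : ∀ s ∈ X.R x.1.1, s < X.t (X.lo x) → (∃ j, X.γ x.1.1 s ∈ X.L j) → s ≤ u :=
    fun s h1 h2 h3 => hmax s ⟨⟨h1, h3⟩, h2⟩
  refine ⟨u, huR, hlt, j', hu, fun s hus hs => ⟨?_, fun k hk => ?_⟩⟩
  · rw [← before_lo]
    refine (X.before_mono _ hs).antisymm fun k hk => ?_
    obtain ⟨s', hs', hlt', hk'⟩ := X.mem_before.1 hk
    exact X.mem_before.2 ⟨s', hs', (hno s' hs' hlt' ⟨k, hk'⟩).trans_lt hus, hk'⟩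
  · have hlt' : s < X.t (X.lo x) := lt_of_le_of_ne hs fun h => X.lo_notMem x k (h ▸ hk)
    have := hno s ((X.ordConnected_R _).out huR (X.lo_mem x) ⟨hus.le, hs⟩) hlt' ⟨k, hk⟩
    linarith

/-- Some column crosses the row of a piece after this piece. -/
def HasRight (x : Set.range X.piece) : Prop :=
  ∃ s ∈ X.R x.1.1, X.t (X.hi x) < s ∧ ∃ j, X.γ x.1.1 s ∈ X.L j

theorem HasRight.exists_right {x : Set.range X.piece} (hx : X.HasRight x) :
    ∃ u ∈ X.R x.1.1, X.t (X.hi x) < u ∧ ∃ j, X.γ x.1.1 u ∈ X.L j ∧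
      ∀ s, s < u → X.t (X.hi x) ≤ s →
        X.before x.1.1 s = x.1.2 ∧ ∀ j, X.γ x.1.1 s ∉ X.L j := by
  obtain ⟨s, hsR, hs, hj⟩ := hx
  obtain ⟨u, ⟨⟨huR, j', hu⟩, hlt⟩, hmin⟩ := Set.exists_min_image
    ({s ∈ X.R x.1.1 | ∃ j, X.γ x.1.1 s ∈ X.L j} ∩ Set.Ioi (X.t (X.hi x))) id
    ((X.finite_cross _).inter_of_left _) ⟨s, ⟨hsR, hj⟩, hs⟩
  have hno : ∀ s ∈ X.R x.1.1, X.t (X.hi x) < s → (∃ j, X.γ x.1.1 s ∈ X.L j) → u ≤ s :=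
    fun s h1 h2 h3 => hmin s ⟨⟨h1, h3⟩, h2⟩
  refine ⟨u, huR, hlt, j', hu, fun s hus hs => ⟨?_, fun k hk => ?_⟩⟩
  · rw [← before_hi]
    refine Finset.Subset.antisymm (fun k hk => ?_) (X.before_mono _ hs)
    obtain ⟨s', hs', hlt', hk'⟩ := X.mem_before.1 hk
    refine X.mem_before.2 ⟨s', hs', ?_, hk'⟩
    by_contra! hle
    rcases hle.lt_or_eq with h | h
    · have := hno s' hs' h ⟨k, hk'⟩
      linarith
    · exact X.hi_notMem x k (h ▸ hk')
  · have hlt' : X.t (X.hi x) < s := lt_of_le_of_ne hs fun h => X.hi_notMem x k (h ▸ hk)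
    have := hno s ((X.ordConnected_R _).out (X.hi_mem x) huR ⟨hs, hus.le⟩) hlt' ⟨k, hk⟩
    linarith

omit [Finite E] in
theorem card_pieces_le_left [Fintype I] [Fintype (Set.range X.piece)]
    [Fintype {x : Set.range X.piece // x.1.2.Nonempty}] : Fintype.card (Set.range X.piece) ≤
      Fintype.card {x : Set.range X.piece // x.1.2.Nonempty} + Fintype.card I := by
  classical
  have h1 : Fintype.card {x : Set.range X.piece // ¬ x.1.2.Nonempty} ≤ Fintype.card I := by
    refine Fintype.card_le_of_injective (fun x => x.1.1.1) fun x y h => ?_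
    refine Subtype.ext (Subtype.ext (Prod.ext h ?_))
    rw [Finset.not_nonempty_iff_eq_empty.1 x.2, Finset.not_nonempty_iff_eq_empty.1 y.2]
  have h2 := Fintype.card_subtype_compl (fun x : Set.range X.piece => x.1.2.Nonempty)
  omega

theorem card_pieces_le_right [Fintype I] [Fintype (Set.range X.piece)]
    [Fintype {x // X.HasRight x}] : Fintype.card (Set.range X.piece) ≤
      Fintype.card {x // X.HasRight x} + Fintype.card I := by
  classical
  have key : ∀ x : Set.range X.piece, ¬ X.HasRight x → ∀ j,
      j ∈ x.1.2 ↔ ∃ s ∈ X.R x.1.1, X.γ x.1.1 s ∈ X.L j := by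
    intro x hx j
    rw [← before_hi, mem_before]
    constructor
    · rintro ⟨s, hs, -, h⟩
      exact ⟨s, hs, h⟩
    · rintro ⟨s, hs, h⟩
      refine ⟨s, hs, lt_of_le_of_ne ?_ ?_, h⟩
      · by_contra! hlt
        exact hx ⟨s, hs, hlt, j, h⟩
      · rintro rfl
        exact X.hi_notMem x j h
  have h1 : Fintype.card {x // ¬ X.HasRight x} ≤ Fintype.card I := by
    refine Fintype.card_le_of_injective (fun x => x.1.1.1) fun x y h => ?_
    refine Subtype.ext (Subtype.ext (Prod.ext h ?_))
    ext j
    have h' : x.1.1.1 = y.1.1.1 := h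
    rw [key _ x.2, key _ y.2, h']
  have h2 := Fintype.card_subtype_compl X.HasRight
  omega

theorem card_pieces [Fintype I] [Fintype (Set.range X.piece)] :
    Fintype.card (Set.range X.piece) + 2 ≤ 2 * Fintype.card I + 2 * Fintype.card J ∨
    2 * Fintype.card (Set.range X.piece) ≤ 2 * Fintype.card I + Fintype.card J := by
  classical
  obtain ⟨T, hTF, hTc, hTp, hT⟩ := IsPathConnected.exists_isCompact_isPreconnected
    (X.isOpen_F.isConnected_iff_isPathConnected.1 X.isConnected_F)
    (p := fun e => (X.σ_inter_F e).some) (fun e => (X.σ_inter_F e).some_mem.2)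
  choose u huR hu col hcol hbl hleft using fun x : {x : Set.range X.piece // x.1.2.Nonempty} =>
    X.exists_left x.2
  choose w hwR hw col' hcol' hbr hright using fun x : {x // X.HasRight x} =>
    HasRight.exists_right X x.2
  let E₁ := Set.range X.piece ⊕ {x : Set.range X.piece // x.1.2.Nonempty} ⊕ {x // X.HasRight x}
  let K : Set.range X.piece ⊕ Option J → Set Pt :=
    Sum.elim X.pieceSet fun o => o.elim T X.L
  let a : E₁ → Set Pt := Sum.elim (fun x => X.σ (X.lo x)) (Sum.elim
    (fun x => X.γ x.1.1.1 '' Set.Icc (u x) (X.t (X.lo x.1)))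
    (fun x => X.γ x.1.1.1 '' Set.Icc (X.t (X.hi x.1)) (w x)))
  let p : E₁ → Set.range X.piece := Sum.elim id (Sum.elim Subtype.val Subtype.val)
  let q : E₁ → Option J := Sum.elim (fun _ => none)
    (Sum.elim (fun x => some (col x)) (fun x => some (col' x)))
  have hTrow : ∀ x (s : ℝ), s ∈ X.R x → X.γ x s ∉ T := fun x s hs h =>
    Set.disjoint_left.1 (X.disjoint_F_row x) (hTF h) ⟨s, hs, rfl⟩
  -- the points of the arcs
  have hstub : ∀ x z, z ∈ X.σ (X.lo x) → z ∈ X.F ∨ z = X.γ x.1.1 (X.t (X.lo x)) := by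
    intro x z hz
    have := X.σ_subset _ hz
    rwa [row_lo] at this
  have harcl : ∀ x z, z ∈ X.γ x.1.1.1 '' Set.Icc (u x) (X.t (X.lo x.1)) →
      z = X.γ x.1.1.1 (u x) ∨ ∃ s ∈ X.R x.1.1.1, X.before x.1.1.1 s = x.1.1.2 ∧
        (∀ j, z ∉ X.L j) ∧ z = X.γ x.1.1.1 s ∧ s ≤ X.t (X.lo x.1) := by
    rintro x _ ⟨s, hs, rfl⟩
    rcases hs.1.eq_or_lt with rfl | h
    · exact Or.inl rfl
    · exact Or.inr ⟨s, (X.ordConnected_R _).out (huR x) (X.lo_mem x.1) hs,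
        hbl x s h hs.2, hleft x s h hs.2, rfl, hs.2⟩
  have harcr : ∀ x z, z ∈ X.γ x.1.1.1 '' Set.Icc (X.t (X.hi x.1)) (w x) →
      z = X.γ x.1.1.1 (w x) ∨ ∃ s ∈ X.R x.1.1.1, X.before x.1.1.1 s = x.1.1.2 ∧
        (∀ j, z ∉ X.L j) ∧ z = X.γ x.1.1.1 s ∧ X.t (X.hi x.1) ≤ s := by
    rintro x _ ⟨s, hs, rfl⟩
    rcases hs.2.eq_or_lt with rfl | h
    · exact Or.inl rfl
    · exact Or.inr ⟨s, (X.ordConnected_R _).out (X.hi_mem x.1) (hwR x) hs,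
        hbr x s h hs.1, hright x s h hs.1, rfl, hs.1⟩
  have harc : ∀ e z, z ∈ a (Sum.inr e) → z ∈ K (Sum.inr (q (Sum.inr e))) ∨
      ∃ s ∈ X.R (p (Sum.inr e)).1.1, X.before (p (Sum.inr e)).1.1 s = (p (Sum.inr e)).1.2 ∧
        (∀ j, z ∉ X.L j) ∧ z = X.γ (p (Sum.inr e)).1.1 s := by
    rintro (x | x) z hz
    · rcases harcl x z hz with rfl | ⟨s, h1, h2, h3, h4, -⟩
      exacts [Or.inl (hcol x), Or.inr ⟨s, h1, h2, h3, h4⟩]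
    · rcases harcr x z hz with rfl | ⟨s, h1, h2, h3, h4, -⟩
      exacts [Or.inl (hcol' x), Or.inr ⟨s, h1, h2, h3, h4⟩]
  have harcR : ∀ e z, z ∈ a (Sum.inr e) → ∃ s ∈ X.R (p (Sum.inr e)).1.1,
      z = X.γ (p (Sum.inr e)).1.1 s := by
    rintro (x | x) _ ⟨s, hs, rfl⟩
    · exact ⟨s, (X.ordConnected_R _).out (huR x) (X.lo_mem x.1) hs, rfl⟩
    · exact ⟨s, (X.ordConnected_R _).out (X.hi_mem x.1) (hwR x) hs, rfl⟩
  have hKK : ∀ v v', v ≠ v' → Disjoint (K v) (K v') := by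
    have hTL : ∀ j, Disjoint T (X.L j) := fun j => (X.disjoint_F_L j).mono_left hTF
    have hTP : ∀ x, Disjoint T (X.pieceSet x) := fun x =>
      (X.disjoint_F_row _).mono hTF (X.pieceSet_subset x)
    rintro (x | _ | j) (y | _ | k) h
    · exact X.disjoint_pieceSet fun hxy => h (hxy ▸ rfl)
    · exact (hTP x).symm
    · exact X.disjoint_pieceSet_L x k
    · exact hTP y
    · exact absurd rfl h
    · exact hTL k
    · exact (X.disjoint_pieceSet_L y j).symm
    · exact (hTL j).symm
    · exact X.disjoint_L j k fun hjk => h (hjk ▸ rfl)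
  have hlomem : ∀ x, X.γ x.1.1 (X.t (X.lo x)) ∈ X.pieceSet x :=
    fun x => ⟨_, ⟨le_rfl, X.lo_le_hi x⟩, rfl⟩
  have hhimem : ∀ x, X.γ x.1.1 (X.t (X.hi x)) ∈ X.pieceSet x :=
    fun x => ⟨_, ⟨X.lo_le_hi x, le_rfl⟩, rfl⟩
  have hsa : ∀ x e, X.σ (X.lo x) ∩ a (Sum.inr e) ⊆ ⋃ v, K v := by
    rintro x e z ⟨hz, hz'⟩
    rcases hstub x z hz with h | rfl
    · obtain ⟨s, hs, rfl⟩ := harcR e z hz'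
      exact absurd ⟨s, hs, rfl⟩ (Set.disjoint_left.1 (X.disjoint_F_row _) h)
    · exact Set.mem_iUnion.2 ⟨Sum.inl x, hlomem x⟩
  have hpp : ∀ e e' z, z ∈ a (Sum.inr e) → z ∈ a (Sum.inr e') → (z ∈ ⋃ v, K v) ∨
      p (Sum.inr e) = p (Sum.inr e') := by
    intro e e' z hz hz'
    rcases harc e z hz with h | ⟨s, hs, hb, hL, rfl⟩
    · exact Or.inl (Set.mem_iUnion.2 ⟨_, h⟩)
    rcases harc e' _ hz' with h | ⟨s', hs', hb', hL', h⟩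
    · exact Or.inl (Set.mem_iUnion.2 ⟨_, h⟩)
    obtain ⟨h1, rfl⟩ := X.eq_of_mem_rows hs hs' h
    exact Or.inr (Subtype.ext (Prod.ext h1 (by rw [← hb, ← hb', h1])))
  have hlr : ∀ x y z, z ∈ a (Sum.inr (Sum.inl x)) → z ∈ a (Sum.inr (Sum.inr y)) →
      z ∈ ⋃ v, K v := by
    intro x y z hz hz'
    rcases hpp _ _ z hz hz' with h | h
    · exact h
    change x.1 = y.1 at h
    rcases harcl x z hz with rfl | ⟨s, hs, -, -, rfl, hle⟩
    · exact Set.mem_iUnion.2 ⟨Sum.inr (some _), hcol x⟩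
    rcases harcr y _ hz' with h' | ⟨s', hs', -, -, h', hle'⟩
    · exact Set.mem_iUnion.2 ⟨Sum.inr (some _), h' ▸ hcol' y⟩
    obtain ⟨-, rfl⟩ := X.eq_of_mem_rows hs hs' h'
    rw [← h] at hle'
    have := X.lo_le_hi x.1
    exact Set.mem_iUnion.2 ⟨Sum.inl x.1, s, ⟨by linarith, by linarith⟩, rfl⟩
  have hcolne : ∀ x y, x.1 = y.1 → col x ≠ col' y := by
    intro x y h hc
    obtain ⟨x, hx⟩ := x
    obtain ⟨y, hy⟩ := y
    obtain rfl : x = y := h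
    have h1 := hcol ⟨x, hx⟩
    have h2 := hcol' ⟨x, hy⟩
    rw [← hc] at h2
    have h3 := X.subsingleton_cross _ _ ⟨huR ⟨x, hx⟩, h1⟩ ⟨hwR ⟨x, hy⟩, h2⟩
    have h4 := hu ⟨x, hx⟩
    have h5 := hw ⟨x, hy⟩
    have := X.lo_le_hi x
    simp only at h3 h4 h5
    linarith
  have hinj : Function.Injective fun e => (s(Sum.inl (p e), Sum.inr (q e)) :
      Sym2 (Set.range X.piece ⊕ Option J)) := by
    intro e e' h
    simp only [Sym2.eq_iff, Sum.inl.injEq, Sum.inr.injEq, reduceCtorEq, and_self, or_false] at h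
    obtain ⟨h1, h2⟩ := h
    rcases e with x | x | x <;> rcases e' with y | y | y <;>
      simp only [p, q, Sum.elim_inl, Sum.elim_inr, id, reduceCtorEq, Option.some.injEq] at h1 h2
    · rw [h1]
    · rw [Subtype.ext h1]
    · exact absurd h2 (hcolne x y h1)
    · exact absurd h2.symm (hcolne y x h1.symm)
    · rw [Subtype.ext h1]
  obtain ⟨F, l, r, h⟩ := exists_isDualPair_of_ends (K := K) (a := a)
    (p := fun e => Sum.inl (p e)) (q := fun e => Sum.inr (q e))
    (by rintro (x | _ | j); exacts [X.isCompact_pieceSet x, hTc, X.isCompact_L j])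
    (by rintro (x | _ | j); exacts [X.isPreconnected_pieceSet x, hTp, X.isPreconnected_L j])
    (by
      rintro (x | x | x)
      exacts [X.isCompact_σ _, isCompact_Icc.image (X.continuous_γ _),
        isCompact_Icc.image (X.continuous_γ _)])
    (by
      rintro (x | x | x)
      exacts [X.isPreconnected_σ _, isPreconnected_Icc.image _ (X.continuous_γ _).continuousOn,
        isPreconnected_Icc.image _ (X.continuous_γ _).continuousOn])
    hKK
    (by
      rintro (x | e) (y | e') hne z ⟨hz, hz'⟩
      · refine absurd hz' (Set.disjoint_left.1 (X.disjoint_c (X.lo x) (X.lo y) fun h => hne ?_)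
          (X.σ_subset_c _ hz) ∘ fun h => X.σ_subset_c _ h)
        have := X.piece_lo x
        rw [h, X.piece_lo y] at this
        rw [Subtype.ext this]
      · exact hsa x e' ⟨hz, hz'⟩
      · exact hsa y e ⟨hz', hz⟩
      · rcases e with x | x <;> rcases e' with y | y
        · rcases hpp _ _ z hz hz' with h | h
          · exact h
          · exact absurd (by rw [show x = y from Subtype.ext h]) hne
        · exact hlr x y z hz hz'
        · exact hlr y x z hz' hz
        · rcases hpp _ _ z hz hz' with h | h
          · exact h
          · exact absurd (by rw [show x = y from Subtype.ext h]) hne)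
    (by rintro e ⟨⟩)
    (by
      rintro (x | x | x)
      · refine ⟨_, ?_, hlomem x⟩
        rw [← row_lo]
        exact X.t_mem_σ _
      · exact ⟨_, ⟨_, ⟨(hu x).le, le_rfl⟩, rfl⟩, hlomem x.1⟩
      · exact ⟨_, ⟨_, ⟨le_rfl, (hw x).le⟩, rfl⟩, hhimem x.1⟩)
    (by
      rintro (x | x | x)
      · exact ⟨_, (X.σ_inter_F _).some_mem.1, hT _⟩
      · exact ⟨_, ⟨_, ⟨le_rfl, (hu x).le⟩, rfl⟩, hcol x⟩
      · exact ⟨_, ⟨_, ⟨(hw x).le, le_rfl⟩, rfl⟩, hcol' x⟩)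
    (by
      rintro (x | e) (y | _ | j) ⟨z, hz, hz'⟩
      · left
        have hzy := X.pieceSet_subset y hz'
        rcases hstub x z hz with h | rfl
        · exact absurd hzy (Set.disjoint_left.1 (X.disjoint_F_row _) h)
        · rw [X.eq_of_mem_pieceSet (X.lo_mem x) (X.before_lo x) hz']
          rfl
      · exact Or.inr rfl
      · exfalso
        rcases hstub x z hz with h | rfl
        · exact Set.disjoint_left.1 (X.disjoint_F_L j) h hz'
        · exact X.lo_notMem x j hz'
      · left
        rcases harc e z hz with h | ⟨s, hs, hb, -, rfl⟩
        · exact absurd hz' (Set.disjoint_left.1 (hKK _ (Sum.inl y) (by simp)) h)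
        · rw [X.eq_of_mem_pieceSet hs hb hz']
      · obtain ⟨s, hs, rfl⟩ := harcR e z hz
        exact absurd hz' (hTrow _ s hs)
      · right
        rcases harc e z hz with h | ⟨s, hs, hb, hL, rfl⟩
        · by_contra hne
          exact Set.disjoint_left.1 (hKK _ _ hne) hz' h
        · exact absurd hz' (hL j))
    hinj
  have hcard := card_le_of_isDualPair_of_bipartite h (side := fun v => v.isLeft)
    (fun e => rfl) (fun e => by simp) hinj
  have h1 := X.card_pieces_le_left
  have h2 := X.card_pieces_le_right
  simp only [E₁, Fintype.card_sum, Fintype.card_option] at hcard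
  omega

include X in
omit [Finite E] in
theorem card_le [Fintype I] [Fintype E] : Fintype.card E = 0 ∨ ∃ N,
    (N + 2 ≤ 2 * Fintype.card I + 2 * Fintype.card J ∨
      2 * N ≤ 2 * Fintype.card I + Fintype.card J) ∧
    (Fintype.card E + 1 ≤ N + Fintype.card J ∨ Fintype.card E + 4 ≤ 2 * (N + Fintype.card J)) := by
  classical
  rcases X.card_curves with h | h
  · exact Or.inl h
  · exact Or.inr ⟨_, X.card_pieces, h⟩

end RowColumn

end Mixed

section Stub

theorem exists_stub_of_Icc {A : Set Pt} (hA : IsClosed A) {x₀ : Pt} {f : ℝ → Pt} {a b : ℝ}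
    (hab : a ≤ b) (hf : ContinuousOn f (Set.Icc a b)) (ha : f a ∈ connectedComponentIn Aᶜ x₀)
    (hb : f b ∈ A) : ∃ x ∈ A, ∃ σ ⊆ f '' Set.Icc a b, IsCompact σ ∧ IsPreconnected σ ∧ x ∈ σ ∧
      (σ ∩ connectedComponentIn Aᶜ x₀).Nonempty ∧ σ ⊆ connectedComponentIn Aᶜ x₀ ∪ {x} := by
  obtain ⟨t, ⟨ht, htA⟩, hmin⟩ :=
    (isCompact_Icc.of_isClosed_subset (hf.preimage_isClosed_of_isClosed isClosed_Icc hA)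
      Set.inter_subset_left).exists_isLeast ⟨b, ⟨hab, le_rfl⟩, hb⟩
  have hsub : Set.Icc a t ⊆ Set.Icc a b := Set.Icc_subset_Icc_right ht.2
  have hcomp : connectedComponentIn Aᶜ x₀ = connectedComponentIn Aᶜ (f a) :=
    connectedComponentIn_eq ha
  have haA : f a ∈ Aᶜ := connectedComponentIn_subset _ _ ha
  have hat : a < t := lt_of_le_of_ne ht.1 fun h => haA (h ▸ htA)
  have hIco : f '' Set.Ico a t ⊆ connectedComponentIn Aᶜ x₀ := by
    rw [hcomp]
    refine (isPreconnected_Ico.image f (hf.mono (Set.Ico_subset_Icc_self.trans hsub))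
      ).subset_connectedComponentIn ⟨a, ⟨le_rfl, hat⟩, rfl⟩ ?_
    rintro _ ⟨s, hs, rfl⟩ hsA
    exact absurd (hmin ⟨hsub (Set.Ico_subset_Icc_self hs), hsA⟩) (not_le.2 hs.2)
  refine ⟨f t, htA, f '' Set.Icc a t, Set.image_mono hsub, isCompact_Icc.image_of_continuousOn
    (hf.mono hsub), isPreconnected_Icc.image f (hf.mono hsub), ⟨t, ⟨hat.le, le_rfl⟩, rfl⟩,
    ⟨f a, ⟨a, ⟨le_rfl, hat.le⟩, rfl⟩, ha⟩, ?_⟩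
  rintro _ ⟨s, hs, rfl⟩
  rcases hs.2.lt_or_eq with h | rfl
  · exact Or.inl (hIco ⟨s, ⟨hs.1, h⟩, rfl⟩)
  · exact Or.inr rfl

theorem IsCurve.exists_stub {A c : Set Pt} (hc : IsCurve c) (hA : IsClosed A) {x₀ : Pt}
    (hF : (connectedComponentIn Aᶜ x₀ ∩ c).Nonempty) (hcA : (c ∩ A).Nonempty) :
    ∃ x ∈ A, ∃ σ ⊆ c, IsCompact σ ∧ IsPreconnected σ ∧ x ∈ σ ∧
      (σ ∩ connectedComponentIn Aᶜ x₀).Nonempty ∧ σ ⊆ connectedComponentIn Aᶜ x₀ ∪ {x} := by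
  obtain ⟨f, hf, -, rfl⟩ := hc
  obtain ⟨_, hp, a, ha, rfl⟩ := hF
  obtain ⟨_, ⟨b, hb, rfl⟩, hbA⟩ := hcA
  rcases le_total a b with h | h
  · have hsub : Set.Icc a b ⊆ Set.Icc 0 1 := Set.Icc_subset_Icc ha.1 hb.2
    obtain ⟨x, hx, σ, hσ, h'⟩ := exists_stub_of_Icc hA h (hf.mono hsub) hp hbA
    exact ⟨x, hx, σ, hσ.trans (Set.image_mono hsub), h'⟩
  · have hmaps : Set.MapsTo (fun t : ℝ => -t) (Set.Icc (-a) (-b)) (Set.Icc 0 1) := by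
      intro t ht
      have h1 := ha.2
      have h2 := hb.1
      exact ⟨by linarith [ht.2], by linarith [ht.1]⟩
    obtain ⟨x, hx, σ, hσ, h'⟩ := exists_stub_of_Icc (f := fun t => f (-t)) (a := -a) (b := -b) hA
      (by linarith) (hf.comp continuous_neg.continuousOn hmaps) (by simpa using hp)
      (by simpa using hbA)
    refine ⟨x, hx, σ, hσ.trans ?_, h'⟩
    rintro _ ⟨t, ht, rfl⟩
    exact ⟨-t, hmaps ht, rfl⟩

theorem IsCurve.isCompact {c : Set Pt} (hc : IsCurve c) : IsCompact c := by
  obtain ⟨f, hf, -, rfl⟩ := hc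
  exact isCompact_Icc.image_of_continuousOn hf

theorem IsCurve.isPreconnected {c : Set Pt} (hc : IsCurve c) : IsPreconnected c := by
  obtain ⟨f, hf, -, rfl⟩ := hc
  exact isPreconnected_Icc.image f hf

end Stub

section Segments

/-- The axis-parallel line at height `y`, which is vertical if `d` holds and horizontal
otherwise. -/
def axisLine (d : Bool) (y x : ℝ) : Pt := bif d then (y, x) else (x, y)

theorem continuous_axisLine (d : Bool) (y : ℝ) : Continuous (axisLine d y) := by
  cases d
  · exact continuous_id.prodMk continuous_const
  · exact continuous_const.prodMk continuous_id

theorem axisLine_inj {d : Bool} {y x y' x' : ℝ} (h : axisLine d y x = axisLine d y' x') :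
    y = y' ∧ x = x' := by
  cases d
  · exact ⟨congrArg Prod.snd h, congrArg Prod.fst h⟩
  · exact ⟨congrArg Prod.fst h, congrArg Prod.snd h⟩

theorem exists_axisLine_of_segment {a b : Pt} (h : a.1 = b.1 ∨ a.2 = b.2) :
    ∃ d y l r, segment ℝ a b = axisLine d y '' Set.Icc l r := by
  obtain ⟨a₁, a₂⟩ := a
  obtain ⟨b₁, b₂⟩ := b
  rcases h with h | h <;> simp only at h <;> subst h
  · refine ⟨true, a₁, min a₂ b₂, max a₂ b₂, ?_⟩
    rw [← Prod.image_mk_segment_right, segment_eq_uIcc]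
    rfl
  · refine ⟨false, a₂, min a₁ b₁, max a₁ b₁, ?_⟩
    rw [← Prod.image_mk_segment_left, segment_eq_uIcc]
    rfl

/-- The smallest interval containing a set. -/
def intervalHull (Q : Set ℝ) : Set ℝ := ⋃ α ∈ Q, ⋃ β ∈ Q, Set.Icc α β

theorem mem_intervalHull {Q : Set ℝ} {t : ℝ} :
    t ∈ intervalHull Q ↔ ∃ α ∈ Q, ∃ β ∈ Q, α ≤ t ∧ t ≤ β := by
  simp only [intervalHull, Set.mem_iUnion, Set.mem_Icc, exists_prop]

theorem subset_intervalHull (Q : Set ℝ) : Q ⊆ intervalHull Q := fun t ht =>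
  mem_intervalHull.2 ⟨t, ht, t, ht, le_rfl, le_rfl⟩

theorem ordConnected_intervalHull (Q : Set ℝ) : (intervalHull Q).OrdConnected := by
  refine ⟨fun s hs t ht u hu => ?_⟩
  obtain ⟨α, hα, -, -, h1, -⟩ := mem_intervalHull.1 hs
  obtain ⟨-, -, β, hβ, -, h2⟩ := mem_intervalHull.1 ht
  exact mem_intervalHull.2 ⟨α, hα, β, hβ, h1.trans hu.1, hu.2.trans h2⟩

theorem isCompact_intervalHull {Q : Set ℝ} (hQ : Q.Finite) : IsCompact (intervalHull Q) :=
  hQ.isCompact_biUnion fun _ _ => hQ.isCompact_biUnion fun _ _ => isCompact_Icc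

/-- Axis-parallel segments and pairwise disjoint curves reaching a common component of the
complement of the segments. -/
structure GroundedSegments (ι κ : Type*) where
  /-- the directions of the segments -/
  d : ι → Bool
  /-- the heights of the segments -/
  y : ι → ℝ
  /-- the initial parameters of the segments -/
  l : ι → ℝ
  /-- the final parameters of the segments -/
  r : ι → ℝ
  /-- the segments -/
  S : ι → Set Pt
  /-- the curves -/
  C : κ → Set Pt
  /-- a point of the component reached by the curves -/
  x₀ : Pt
  S_eq : ∀ i, S i = axisLine (d i) (y i) '' Set.Icc (l i) (r i)
  subsingleton_S : ∀ i j, i ≠ j → (S i ∩ S j).Subsingleton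
  isCurve_C : ∀ k, IsCurve (C k)
  finite_SC : ∀ i k, (S i ∩ C k).Finite
  encard_le : ∀ p : Pt, ({x : ι ⊕ κ | p ∈ Sum.elim S C x}).encard ≤ 2
  disjoint_C : ∀ k k', k ≠ k' → Disjoint (C k) (C k')
  notMem : x₀ ∉ ⋃ i, S i
  grounded : ∀ k, (connectedComponentIn (⋃ i, S i)ᶜ x₀ ∩ C k).Nonempty

namespace GroundedSegments

variable {ι κ : Type*} [Fintype ι] [Finite κ] (X : GroundedSegments ι κ)

/-- The parameters of the points of a segment on curves or on perpendicular segments. -/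
def param (i : ι) : Set ℝ :=
  {t ∈ Set.Icc (X.l i) (X.r i) | (∃ k, axisLine (X.d i) (X.y i) t ∈ X.C k) ∨
    ∃ j, X.d j ≠ X.d i ∧ axisLine (X.d i) (X.y i) t ∈ X.S j}

/-- The part of a segment spanned by its points on curves or on perpendicular segments. -/
def core (i : ι) : Set Pt := axisLine (X.d i) (X.y i) '' intervalHull (X.param i)

/-- The component reached by the curves. -/
def face : Set Pt := connectedComponentIn (⋃ i, X.S i)ᶜ X.x₀

omit [Fintype ι] [Finite κ] in
theorem false_of_three {p : Pt} {x y z : ι ⊕ κ} (hxy : x ≠ y) (hxz : x ≠ z) (hyz : y ≠ z)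
    (hx : p ∈ Sum.elim X.S X.C x) (hy : p ∈ Sum.elim X.S X.C y)
    (hz : p ∈ Sum.elim X.S X.C z) : False := by
  have h1 : ({x, y, z} : Set (ι ⊕ κ)).encard = 3 :=
    Set.encard_eq_three.2 ⟨x, y, z, hxy, hxz, hyz, rfl⟩
  have h2 : ({x, y, z} : Set (ι ⊕ κ)) ⊆ {x | p ∈ Sum.elim X.S X.C x} := by
    rintro w (rfl | rfl | rfl)
    exacts [hx, hy, hz]
  have h3 := (Set.encard_le_encard h2).trans (X.encard_le p)
  rw [h1] at h3
  norm_num at h3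

omit [Fintype ι] [Finite κ] in
theorem injective_axisLine (i : ι) : Function.Injective (axisLine (X.d i) (X.y i)) :=
  fun _ _ h => (axisLine_inj h).2

theorem finite_param (i : ι) : (X.param i).Finite := by
  have h : (⋃ k, X.S i ∩ X.C k) ∪ (⋃ j, ⋃ _ : X.d j ≠ X.d i, X.S i ∩ X.S j) |>.Finite := by
    refine (Set.finite_iUnion fun k => X.finite_SC i k).union (Set.finite_iUnion fun j =>
      Set.finite_iUnion fun hj => (X.subsingleton_S i j ?_).finite)
    rintro rfl
    exact hj rfl
  refine (h.preimage (X.injective_axisLine i).injOn).subset ?_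
  rintro t ⟨ht, h | ⟨j, hj, h⟩⟩
  · have hS : axisLine (X.d i) (X.y i) t ∈ X.S i := X.S_eq i ▸ ⟨t, ht, rfl⟩
    obtain ⟨k, hk⟩ := h
    exact Or.inl (Set.mem_iUnion.2 ⟨k, hS, hk⟩)
  · have hS : axisLine (X.d i) (X.y i) t ∈ X.S i := X.S_eq i ▸ ⟨t, ht, rfl⟩
    exact Or.inr (Set.mem_iUnion.2 ⟨j, Set.mem_iUnion.2 ⟨hj, hS, h⟩⟩)

omit [Fintype ι] [Finite κ] in
theorem intervalHull_param_subset (i : ι) :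
    intervalHull (X.param i) ⊆ Set.Icc (X.l i) (X.r i) := by
  intro t ht
  obtain ⟨α, hα, β, hβ, h1, h2⟩ := mem_intervalHull.1 ht
  exact ⟨hα.1.1.trans h1, h2.trans hβ.1.2⟩

omit [Fintype ι] [Finite κ] in
theorem core_subset (i : ι) : X.core i ⊆ X.S i := by
  rw [S_eq]
  exact Set.image_mono (X.intervalHull_param_subset i)

theorem isCompact_core (i : ι) : IsCompact (X.core i) :=
  (isCompact_intervalHull (X.finite_param i)).image (continuous_axisLine _ _)

omit [Fintype ι] [Finite κ] in
theorem isPreconnected_core (i : ι) : IsPreconnected (X.core i) :=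
  (ordConnected_intervalHull _).isPreconnected.image _ (continuous_axisLine _ _).continuousOn

omit [Fintype ι] [Finite κ] in
theorem exists_param_of_mem_C {i : ι} {k : κ} {p : Pt} (hp : p ∈ X.S i) (hk : p ∈ X.C k) :
    ∃ t ∈ X.param i, axisLine (X.d i) (X.y i) t = p := by
  rw [S_eq] at hp
  obtain ⟨t, ht, rfl⟩ := hp
  exact ⟨t, ⟨ht, Or.inl ⟨k, hk⟩⟩, rfl⟩

omit [Fintype ι] [Finite κ] in
theorem mem_core_of_mem_C {i : ι} {k : κ} {p : Pt} (hp : p ∈ X.S i) (hk : p ∈ X.C k) :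
    p ∈ X.core i := by
  obtain ⟨t, ht, rfl⟩ := X.exists_param_of_mem_C hp hk
  exact ⟨t, subset_intervalHull _ ht, rfl⟩

omit [Fintype ι] [Finite κ] in
theorem disjoint_core {i j : ι} (hij : i ≠ j) (hd : X.d i = X.d j) :
    Disjoint (X.core i) (X.core j) := by
  have key : ∀ i j : ι, i ≠ j → X.d i = X.d j → X.y i = X.y j → ∀ q α α', α ∈ X.param i →
      α' ∈ X.param j → q ≤ X.r i → α' ≤ q → α ≤ α' → False := by
    intro i j hij hd hy q α α' hα hα' hq hα'q hle
    have hi : axisLine (X.d j) (X.y j) α' ∈ X.S i := by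
      rw [S_eq, hd, hy]
      exact ⟨α', ⟨hα.1.1.trans hle, hα'q.trans hq⟩, rfl⟩
    have hj : axisLine (X.d j) (X.y j) α' ∈ X.S j := by
      rw [S_eq]
      exact ⟨α', hα'.1, rfl⟩
    have hne : (Sum.inl i : ι ⊕ κ) ≠ Sum.inl j := fun h => hij (Sum.inl.inj h)
    rcases hα'.2 with ⟨k, hk⟩ | ⟨m, hm, hmS⟩
    · exact X.false_of_three (z := Sum.inr k) hne (by simp) (by simp) hi hj hk
    · refine X.false_of_three (z := Sum.inl m) hne ?_ ?_ hi hj hmS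
      · intro h
        exact hm (Sum.inl.inj h ▸ hd)
      · intro h
        exact hm (Sum.inl.inj h ▸ rfl)
  rw [Set.disjoint_left]
  rintro _ ⟨q, hq, rfl⟩ ⟨q', hq', h⟩
  rw [hd] at h
  obtain ⟨hy, rfl⟩ := axisLine_inj h
  have hqi := X.intervalHull_param_subset i hq
  have hqj := X.intervalHull_param_subset j hq'
  obtain ⟨α, hα, -, -, hαq, -⟩ := mem_intervalHull.1 hq
  obtain ⟨α', hα', -, -, hα'q, -⟩ := mem_intervalHull.1 hq'
  rcases le_total α α' with h | h
  · exact key i j hij hd hy.symm _ α α' hα hα' hqi.2 hα'q h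
  · exact key j i hij.symm hd.symm hy _ α' α hα' hα hqj.2 hαq h

/-- The curve `k` meets the segments `i` and `j` and no other segment. -/
def Links (k : κ) (i j : ι) : Prop :=
  (X.C k ∩ X.S i).Nonempty ∧ (X.C k ∩ X.S j).Nonempty ∧
    ∀ l, (X.C k ∩ X.S l).Nonempty → l = i ∨ l = j

/-- The curve `k` meets the segment `i` at a point connected to the face by a part of `k` not
meeting other segments. -/
def Starts (k : κ) (i : ι) : Prop :=
  ∃ x ∈ X.S i, ∃ σ ⊆ X.C k, IsCompact σ ∧ IsPreconnected σ ∧ x ∈ σ ∧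
    (σ ∩ X.face).Nonempty ∧ σ ⊆ X.face ∪ {x}

variable {X}

omit [Fintype ι] [Finite κ] in
theorem Links.pair_eq {k : κ} {i j i' j' : ι} (h : X.Links k i j) (h' : X.Links k i' j') :
    ({i, j} : Set ι) = {i', j'} := by
  have key : ∀ {i j}, X.Links k i j → ({i, j} : Set ι) = {l | (X.C k ∩ X.S l).Nonempty} := by
    intro i j h
    ext l
    constructor
    · rintro (rfl | rfl)
      exacts [h.1, h.2.1]
    · exact h.2.2 l
  rw [key h, key h']

omit [Finite κ] in
theorem isClosed_iUnion_S (X : GroundedSegments ι κ) : IsClosed (⋃ i, X.S i) := by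
  refine isClosed_iUnion_of_finite fun i => ?_
  rw [S_eq]
  exact (isCompact_Icc.image (continuous_axisLine _ _)).isClosed

omit [Finite κ] in
theorem Links.starts {k : κ} {i j : ι} (h : X.Links k i j) : X.Starts k i ∨ X.Starts k j := by
  obtain ⟨z, hz, hz'⟩ := h.1
  obtain ⟨x, hx, σ, hσ, h1, h2, hxσ, h3⟩ := (X.isCurve_C k).exists_stub X.isClosed_iUnion_S
    (X.grounded k) ⟨z, hz, Set.mem_iUnion.2 ⟨i, hz'⟩⟩
  obtain ⟨l, hl⟩ := Set.mem_iUnion.1 hx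
  have hst : X.Starts k l := ⟨x, hl, σ, hσ, h1, h2, hxσ, h3⟩
  rcases h.2.2 l ⟨x, hσ hxσ, hl⟩ with rfl | rfl
  exacts [Or.inl hst, Or.inr hst]

variable (X) [DecidableEq ι]

/-- The edges between two segments of direction `b`. -/
def parallelEdges (b : Bool) : Set (Finset ι) :=
  {P | ∃ i j k, P = {i, j} ∧ i ≠ j ∧ X.d i = b ∧ X.d j = b ∧ X.Links k i j}

/-- The edges between two perpendicular segments whose curve starts at the segment of
direction `b`. -/
def crossEdges (b : Bool) : Set (Finset ι) :=
  {P | ∃ i j k, P = {i, j} ∧ X.d i = b ∧ X.d j ≠ b ∧ X.Links k i j ∧ X.Starts k i}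

omit [Finite κ] in
theorem setOf_links_subset : {P : Finset ι | P.card = 2 ∧ ∃ i ∈ P, ∃ j ∈ P, i ≠ j ∧
    ∃ k, X.Links k i j} ⊆ (X.parallelEdges true ∪ X.parallelEdges false) ∪
      (X.crossEdges true ∪ X.crossEdges false) := by
  rintro P ⟨hP, i, hi, j, hj, hij, k, hk⟩
  have hP : P = {i, j} := by
    symm
    apply Finset.eq_of_subset_of_card_le
    · intro l
      simp only [Finset.mem_insert, Finset.mem_singleton]
      rintro (rfl | rfl)
      exacts [hi, hj]
    · rw [hP, Finset.card_pair hij]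
  have hk' : X.Links k j i := ⟨hk.2.1, hk.1, fun l hl => (hk.2.2 l hl).symm⟩
  have hP' : P = {j, i} := by rw [hP, Finset.pair_comm]
  rcases hdi : X.d i <;> rcases hdj : X.d j
  · exact Or.inl (Or.inr ⟨i, j, k, hP, hij, hdi, hdj, hk⟩)
  · right
    rcases hk.starts with h | h
    · exact Or.inr ⟨i, j, k, hP, hdi, by simp [hdj], hk, h⟩
    · exact Or.inl ⟨j, i, k, hP', hdj, by simp [hdi], hk', h⟩
  · right
    rcases hk.starts with h | h
    · exact Or.inl ⟨i, j, k, hP, hdi, by simp [hdj], hk, h⟩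
    · exact Or.inr ⟨j, i, k, hP', hdj, by simp [hdi], hk', h⟩
  · exact Or.inl (Or.inl ⟨i, j, k, hP, hij, hdi, hdj, hk⟩)

theorem ncard_parallelEdges (b : Bool) : (X.parallelEdges b).ncard = 0 ∨
    (X.parallelEdges b).ncard + 1 ≤ Fintype.card {i // X.d i = b} ∨
    (X.parallelEdges b).ncard + 6 ≤ 3 * Fintype.card {i // X.d i = b} := by
  classical
  choose i j k hP hij hi hj hk using fun P : X.parallelEdges b => P.2
  have hdisj : ∀ e e', e ≠ e' → Disjoint (X.C (k e)) (X.C (k e')) := by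
    refine fun e e' h => X.disjoint_C _ _ fun hkk => h (Subtype.ext ?_)
    have h1 := hk e
    rw [hkk] at h1
    have := h1.pair_eq (hk e')
    rw [hP, hP, ← Finset.coe_inj]
    simpa using this
  have hinj : Function.Injective fun e =>
      (s(⟨i e, hi e⟩, ⟨j e, hj e⟩) : Sym2 {i // X.d i = b}) := by
    intro e e' h
    simp only [Sym2.eq_iff, Subtype.mk.injEq] at h
    refine Subtype.ext ?_
    rw [hP, hP]
    rcases h with ⟨h, h'⟩ | ⟨h, h'⟩
    · rw [h, h']
    · rw [h, h', Finset.pair_comm]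
  have hne : ∀ e, (⟨i e, hi e⟩ : {i // X.d i = b}) ≠ ⟨j e, hj e⟩ :=
    fun e h => hij e (congrArg Subtype.val h)
  obtain ⟨F, l, r, h⟩ := exists_isDualPair_of_ends (V := {i // X.d i = b})
    (K := fun v => X.core v) (a := fun e => X.C (k e)) (p := fun e => ⟨i e, hi e⟩)
    (q := fun e => ⟨j e, hj e⟩) (fun v => X.isCompact_core v) (fun v => X.isPreconnected_core v)
    (fun e => (X.isCurve_C _).isCompact) (fun e => (X.isCurve_C _).isPreconnected)
    (fun u v huv => X.disjoint_core (fun h => huv (Subtype.ext h)) (u.2.trans v.2.symm))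
    (fun e e' h => by
      rw [Set.disjoint_iff_inter_eq_empty.1 (hdisj e e' h)]
      exact Set.empty_subset _)
    hne
    (fun e => (hk e).1.mono fun z hz => ⟨hz.1, X.mem_core_of_mem_C hz.2 hz.1⟩)
    (fun e => (hk e).2.1.mono fun z hz => ⟨hz.1, X.mem_core_of_mem_C hz.2 hz.1⟩)
    (fun e v hv => by
      rcases (hk e).2.2 v (hv.mono (Set.inter_subset_inter_right _ (X.core_subset _))) with h | h
      · exact Or.inl (Subtype.ext h)
      · exact Or.inr (Subtype.ext h))
    hinj
  have := card_le_of_isDualPair_of_simple h hne hinj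
  rwa [← Nat.card_eq_fintype_card (α := X.parallelEdges b), Nat.card_coe_set_eq] at this

theorem ncard_crossEdges (b : Bool) : (X.crossEdges b).ncard = 0 ∨ ∃ N,
    (N + 2 ≤ 2 * Fintype.card {i // X.d i = b} + 2 * Fintype.card {i // X.d i ≠ b} ∨
      2 * N ≤ 2 * Fintype.card {i // X.d i = b} + Fintype.card {i // X.d i ≠ b}) ∧
    ((X.crossEdges b).ncard + 1 ≤ N + Fintype.card {i // X.d i ≠ b} ∨
      (X.crossEdges b).ncard + 4 ≤ 2 * (N + Fintype.card {i // X.d i ≠ b})) := by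
  classical
  choose i j k hP hi hj hk x hxS σ hσC hσc hσp hxσ hσF hσ using fun P : X.crossEdges b => P.2
  choose t ht htx using fun e => X.exists_param_of_mem_C (hxS e) (hσC e (hxσ e))
  have hinj : ∀ e e', i e = i e' → j e = j e' → e = e' := by
    intro e e' h h'
    refine Subtype.ext ?_
    rw [hP, hP, h, h']
  have hdisj : ∀ e e', e ≠ e' → Disjoint (X.C (k e)) (X.C (k e')) := by
    refine fun e e' h => X.disjoint_C _ _ fun hkk => h (Subtype.ext ?_)
    have h1 := hk e
    rw [hkk] at h1
    have := h1.pair_eq (hk e')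
    rw [hP, hP, ← Finset.coe_inj]
    simpa using this
  have hface : ∀ i, Disjoint X.face (X.S i) := fun i =>
    Set.disjoint_left.2 fun z hz hzi =>
      connectedComponentIn_subset _ _ hz (Set.mem_iUnion.2 ⟨i, hzi⟩)
  let Y : RowColumn {i // X.d i = b} {i // X.d i ≠ b} (X.crossEdges b) :=
    { γ := fun v => axisLine (X.d v) (X.y v)
      R := fun v => intervalHull (X.param v)
      L := fun v => X.core v
      row := fun e => ⟨i e, hi e⟩
      col := fun e => ⟨j e, hj e⟩
      t := t
      c := fun e => X.C (k e)
      σ := σ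
      F := X.face
      continuous_γ := fun v => continuous_axisLine _ _
      injective_γ := fun v => X.injective_axisLine v
      ordConnected_R := fun v => ordConnected_intervalHull _
      disjoint_row := fun u v huv =>
        X.disjoint_core (fun h => huv (Subtype.ext h)) (u.2.trans v.2.symm)
      isCompact_L := fun v => X.isCompact_core v
      isPreconnected_L := fun v => X.isPreconnected_core v
      disjoint_L := fun u v huv => X.disjoint_core (fun h => huv (Subtype.ext h))
        ((Bool.eq_not_of_ne u.2).trans (Bool.eq_not_of_ne v.2).symm)
      subsingleton_cross := fun u v s hs s' hs' => X.injective_axisLine u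
        (X.subsingleton_S u v (fun h => v.2 (h ▸ u.2))
          ⟨X.core_subset u ⟨s, hs.1, rfl⟩, X.core_subset v hs.2⟩
          ⟨X.core_subset u ⟨s', hs'.1, rfl⟩, X.core_subset v hs'.2⟩)
      injective_row_col := fun e e' h h' =>
        hinj e e' (congrArg Subtype.val h) (congrArg Subtype.val h')
      t_mem := fun e => subset_intervalHull _ (ht e)
      t_notMem := fun e v hv => by
        have hv' := X.core_subset v hv
        simp only [htx] at hv'
        refine X.false_of_three (x := Sum.inl (i e)) (y := Sum.inl v.1) (z := Sum.inr (k e)) ?_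
          (by simp) (by simp) (hxS e) hv' (hσC e (hxσ e))
        intro h
        exact v.2 (Sum.inl.inj h ▸ hi e)
      isCompact_c := fun e => (X.isCurve_C _).isCompact
      isPreconnected_c := fun e => (X.isCurve_C _).isPreconnected
      disjoint_c := hdisj
      c_inter_col := fun e =>
        (hk e).2.1.mono fun z hz => ⟨hz.1, X.mem_core_of_mem_C hz.2 hz.1⟩
      eq_col := fun e v hv => by
        rcases (hk e).2.2 v (hv.mono (Set.inter_subset_inter_right _ (X.core_subset _)))
          with h | h
        · exact absurd (h ▸ hi e) v.2
        · exact Subtype.ext h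
      t_mem_c := fun e => (htx e).symm ▸ hσC e (hxσ e)
      eq_row := fun e v hv => by
        rcases (hk e).2.2 v (hv.mono (Set.inter_subset_inter_right _ (X.core_subset _)))
          with h | h
        · exact Subtype.ext h
        · exact absurd (h ▸ v.2) (hj e)
      isOpen_F := X.isClosed_iUnion_S.isOpen_compl.connectedComponentIn
      isConnected_F := isConnected_connectedComponentIn_iff.2 X.notMem
      disjoint_F_row := fun v => (hface v).mono_right (X.core_subset v)
      disjoint_F_L := fun v => (hface v).mono_right (X.core_subset v)
      isCompact_σ := hσc
      isPreconnected_σ := hσp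
      σ_subset_c := hσC
      t_mem_σ := fun e => (htx e).symm ▸ hxσ e
      σ_inter_F := hσF
      σ_subset := fun e => (htx e).symm ▸ hσ e }
  have := Y.card_le
  rwa [← Nat.card_eq_fintype_card (α := X.crossEdges b), Nat.card_coe_set_eq] at this

theorem ncard_links_le : {P : Finset ι | P.card = 2 ∧ ∃ i ∈ P, ∃ j ∈ P, i ≠ j ∧
    ∃ k, X.Links k i j}.ncard ≤ 13 * Fintype.card ι - 11 := by
  have h := (Set.ncard_le_ncard X.setOf_links_subset (Set.toFinite _)).trans
    ((Set.ncard_union_le _ _).trans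
      (add_le_add (Set.ncard_union_le _ _) (Set.ncard_union_le _ _)))
  have h1 := X.ncard_parallelEdges true
  have h2 := X.ncard_parallelEdges false
  have h3 := X.ncard_crossEdges true
  have h4 := X.ncard_crossEdges false
  have h5 := Fintype.card_subtype_compl fun i => X.d i = true
  have h6 := Fintype.card_subtype_le fun i => X.d i = true
  have h7 : Fintype.card {i // X.d i ≠ true} = Fintype.card {i // X.d i = false} :=
    Fintype.card_congr (Equiv.subtypeEquivRight fun i => by simp)
  have h8 : Fintype.card {i // X.d i ≠ false} = Fintype.card {i // X.d i = true} :=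
    Fintype.card_congr (Equiv.subtypeEquivRight fun i => by simp)
  rw [h7] at h3 h5
  rw [h8] at h4
  rcases h3 with h3 | ⟨N, h3, h3'⟩ <;> rcases h4 with h4 | ⟨N', h4, h4'⟩ <;> omega

end GroundedSegments

end Segments

theorem stmt3 (n m : ℕ) (S : Fin n → Set Pt) (C : Fin m → Set Pt)
    -- the members of `S` are nondegenerate axis-parallel line segments
    (hseg : ∀ i : Fin n, ∃ a b : Pt, (a.1 = b.1 ∨ a.2 = b.2) ∧ a ≠ b ∧ S i = segment ℝ a b)
    -- no two segments overlap in more than one point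
    (hover : ∀ i j : Fin n, i ≠ j → (S i ∩ S j).Subsingleton)
    (hCcurve : ∀ k, IsPolygonalCurve (C k))
    -- every segment and every curve intersect in finitely many points
    (hSCfin : ∀ i k, (S i ∩ C k).Finite)
    -- no point belongs to more than two of the curves considered
    (htriple : ∀ p : Pt, ({x : Fin n ⊕ Fin m | p ∈ Sum.elim S C x}).encard ≤ 2)
    -- the curves of `C` are pairwise disjoint
    (hCdisj : ∀ k l : Fin m, k ≠ l → Disjoint (C k) (C l))
    -- `C` is grounded with respect to `S`
    (hground : Grounded C S) :
    -- the Delaunay graph `D(S, C)` has at most `13 n - 11` edges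
    {P : Finset (Fin n) | P.card = 2 ∧ ∃ i ∈ P, ∃ j ∈ P, i ≠ j ∧
      ∃ k : Fin m, (C k ∩ S i).Nonempty ∧ (C k ∩ S j).Nonempty ∧
        ∀ l : Fin n, (C k ∩ S l).Nonempty → l = i ∨ l = j}.ncard ≤ 13 * n - 11 := by
  have hline : ∀ i, ∃ d y l r, S i = axisLine d y '' Set.Icc l r := by
    intro i
    obtain ⟨a, b, hab, -, h⟩ := hseg i
    rw [h]
    exact exists_axisLine_of_segment hab
  choose d y l r hS using hline
  obtain ⟨x₀, hx₀, hg⟩ := hground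
  let X : GroundedSegments (Fin n) (Fin m) :=
    { d := d, y := y, l := l, r := r, S := S, C := C, x₀ := x₀, S_eq := hS
      subsingleton_S := hover
      isCurve_C := fun k => (hCcurve k).1
      finite_SC := hSCfin
      encard_le := htriple
      disjoint_C := hCdisj
      notMem := hx₀
      grounded := hg }
  have h := X.ncard_links_le
  rwa [Fintype.card_fin] at h
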